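/- arXiv:1512.03282 — 4 statements merged into one kernel-verified Lean document; each statement's English description precedes it below -/
import Mathlib

section
/- Let n ≥ 1 and let X be a random vector in ℝ^n with P(X = 0) = 0 satisfying E⟨X/|X|, θ⟩² ≤ 5/n for all unit vectors θ ∈ S^{n-1}. Let M > 0 satisfy P(|X| ≥ M) ≥ 1/3 and P(|X| ≤ M) ≥ 2/3. Then for every θ ∈ S^{n-1}, P(|⟨X, θ⟩| ≥ 6·M/√n) < 1/2. In particular, every median of |⟨X, θ⟩| is at most 6·M/√n. -/
open MeasureTheory Metric
open scoped ENNReal RealInnerProductSpace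

noncomputable section

/-- **Lemma 3.1.** Let `X` be a random vector in `ℝⁿ` with `P(X = 0) = 0` and
`E ⟨X/|X|, θ⟩² ≤ 5/n` for all unit vectors `θ`, and let `M > 0` be a `1/3`-quantile of
`|X|`. Then `P(|⟨X, θ⟩| ≥ 6M/√n) < 1/2` for every unit vector `θ`; in particular every
median of `|⟨X, θ⟩|` is at most `6M/√n`. -/
theorem median_of_marginal_le
    (n : ℕ) (hn : 1 ≤ n)
    (Ω : Type) (_ : MeasurableSpace Ω) (P : Measure Ω)
    (hP : IsProbabilityMeasure P)
    (X : Ω → EuclideanSpace ℝ (Fin n)) (hX : Measurable X)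
    (hX0 : P {ω | X ω = 0} = 0)
    (hiso : ∀ θ : EuclideanSpace ℝ (Fin n), ‖θ‖ = 1 →
      ∫ ω, ⟪‖X ω‖⁻¹ • X ω, θ⟫ ^ 2 ∂P ≤ 5 / n)
    (M : ℝ) (hM : 0 < M)
    (hM1 : (1 / 3 : ℝ≥0∞) ≤ P {ω | M ≤ ‖X ω‖})
    (hM2 : (2 / 3 : ℝ≥0∞) ≤ P {ω | ‖X ω‖ ≤ M}) :
    ∀ θ : EuclideanSpace ℝ (Fin n), ‖θ‖ = 1 →
      (P {ω | 6 * M / Real.sqrt n ≤ |⟪X ω, θ⟫|} < 1 / 2 ∧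
        ∀ m : ℝ, 0 ≤ m →
          (1 / 2 : ℝ≥0∞) ≤ P {ω | m ≤ |⟪X ω, θ⟫|} →
          (1 / 2 : ℝ≥0∞) ≤ P {ω | |⟪X ω, θ⟫| ≤ m} →
          m ≤ 6 * M / Real.sqrt n) := by
  intro θ hθ
  have hn' : (0 : ℝ) < n := by exact_mod_cast hn
  have hs : 0 < Real.sqrt n := Real.sqrt_pos.2 hn'
  have hsq : Real.sqrt n ^ 2 = n := Real.sq_sqrt hn'.le
  set f : Ω → ℝ := fun ω => ⟪‖X ω‖⁻¹ • X ω, θ⟫ ^ 2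
  have hfm : Measurable f := by
    have : Measurable fun ω => ‖X ω‖⁻¹ • X ω := hX.norm.inv.smul hX
    exact (this.inner measurable_const).pow_const 2
  have hf1 : ∀ ω, f ω ≤ 1 := by
    intro ω
    have h1 : |⟪‖X ω‖⁻¹ • X ω, θ⟫| ≤ 1 := by
      refine (abs_real_inner_le_norm _ _).trans ?_
      rw [hθ, mul_one, norm_smul, norm_inv, norm_norm]
      exact inv_mul_le_one
    exact (sq_le_one_iff_abs_le_one _).2 h1
  have hfi : Integrable f P := by
    refine Integrable.of_bound hfm.aestronglyMeasurable 1 (Filter.Eventually.of_forall fun ω => ?_)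
    rw [Real.norm_of_nonneg (sq_nonneg _)]
    exact hf1 ω
  have hmarkov : P.real {ω | 36 / (n : ℝ) ≤ f ω} ≤ 5 / 36 := by
    have h := mul_meas_ge_le_integral_of_nonneg
      (Filter.Eventually.of_forall fun ω => sq_nonneg _) hfi (36 / (n : ℝ))
    have h2 := h.trans (hiso θ hθ)
    rw [div_mul_eq_mul_div, div_le_div_iff_of_pos_right hn'] at h2
    linarith
  have htail : P.real {ω | M < ‖X ω‖} ≤ 1 / 3 := by
    have hm : MeasurableSet {ω | ‖X ω‖ ≤ M} := measurableSet_le hX.norm measurable_const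
    have hc : {ω | M < ‖X ω‖} = {ω | ‖X ω‖ ≤ M}ᶜ := by ext; simp
    have h2 : (2 / 3 : ℝ) ≤ P.real {ω | ‖X ω‖ ≤ M} := by
      have := ENNReal.toReal_mono (measure_ne_top P _) hM2
      simpa [Measure.real] using this
    rw [hc, probReal_compl_eq_one_sub hm]
    linarith
  have hsub : {ω | 6 * M / Real.sqrt n ≤ |⟪X ω, θ⟫|} ⊆
      {ω | 36 / (n : ℝ) ≤ f ω} ∪ {ω | M < ‖X ω‖} := by
    intro ω hω
    simp only [Set.mem_ofPred_eq, Set.mem_union] at hω ⊢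
    by_cases hle : M < ‖X ω‖
    · exact Or.inr hle
    left
    have hpos : 0 < ‖X ω‖ := by
      rw [norm_pos_iff]
      intro h0
      rw [h0, inner_zero_left, abs_zero] at hω
      exact absurd hω (not_le.2 (by positivity))
    have h1 : 6 / Real.sqrt n ≤ |⟪‖X ω‖⁻¹ • X ω, θ⟫| := by
      rw [real_inner_smul_left, abs_mul, abs_inv, abs_norm, inv_mul_eq_div, le_div_iff₀ hpos]
      calc 6 / Real.sqrt n * ‖X ω‖ ≤ 6 / Real.sqrt n * M := by
            gcongr
            exact not_lt.1 hle
        _ = 6 * M / Real.sqrt n := by ring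
        _ ≤ _ := hω
    calc 36 / (n : ℝ) = (6 / Real.sqrt n) ^ 2 := by rw [div_pow, hsq]; norm_num
      _ ≤ |⟪‖X ω‖⁻¹ • X ω, θ⟫| ^ 2 := by gcongr
      _ = f ω := sq_abs _
  have hmain : P {ω | 6 * M / Real.sqrt n ≤ |⟪X ω, θ⟫|} < 1 / 2 := by
    have hreal : P.real {ω | 6 * M / Real.sqrt n ≤ |⟪X ω, θ⟫|} < 1 / 2 := by
      have h1 := (measureReal_mono hsub).trans (measureReal_union_le (μ := P) _ _)
      linarith
    rw [← ENNReal.toReal_lt_toReal (measure_ne_top P _) (by simp)]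
    simpa [Measure.real] using hreal
  refine ⟨hmain, fun m _ hm _ => ?_⟩
  by_contra! hlt
  refine absurd (hm.trans (measure_mono fun ω hω => ?_)) (not_le.2 hmain)
  exact hlt.le.trans hω
end
end

section
/- There exist universal constants c1, c2, C3, c, C > 0 such that the following holds. Let 1 ≤ k ≤ n and fix (v_1,…,v_k) ∈ O_k. Then there exists a subset F ⊆ S^{n-1} with σ_{n-1}(F) ≥ 1 − C·exp(−c·√k) such that for every θ ∈ F and every 0 ≤ t ≤ √(log k), the number of indices 1 ≤ i ≤ k with ⟨v_i, θ⟩ ≥ c1·(|v_i|/√n)·t is at least c2·e^{−C3·t²}·k. -/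
open MeasureTheory Metric
open scoped ENNReal RealInnerProductSpace

noncomputable section

/-- The uniform (rotation-invariant) probability measure on the unit sphere
`S^{n-1} ⊆ ℝⁿ`, obtained by normalizing the surface measure. -/
def sphereMeasure (n : ℕ) : Measure (sphere (0 : EuclideanSpace ℝ (Fin n)) 1) :=
  (((volume : Measure (EuclideanSpace ℝ (Fin n))).toSphere Set.univ)⁻¹) •
    (volume : Measure (EuclideanSpace ℝ (Fin n))).toSphere

/-- The family `O_k` of almost-orthogonal `k`-tuples in `ℝⁿ`: there are orthonormal
vectors `w_1, …, w_k` and scalars `(a_{ij})_{j ≤ i}` with `|a_{ij}| < a_{ii}/k²` for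
`j < i`, such that `v_i = ∑_{j ≤ i} a_{ij} w_j`. -/
def InOk {n : ℕ} (k : ℕ) (v : Fin k → EuclideanSpace ℝ (Fin n)) : Prop :=
  ∃ (w : Fin k → EuclideanSpace ℝ (Fin n)) (a : Fin k → Fin k → ℝ),
    Orthonormal ℝ w ∧
    (∀ i j : Fin k, j < i → |a i j| < a i i / (k : ℝ) ^ 2) ∧
    ∀ i : Fin k, v i = ∑ j ∈ Finset.Iic i, a i j • w j

open ProbabilityTheory

section Polar

variable {E : Type*} [NormedAddCommGroup E]

/-- A measure with radial density factors over the sphere and the half-line: on cones it is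
proportional to the surface measure. -/
theorem withDensity_norm_apply_cone [NormedSpace ℝ E] [FiniteDimensional ℝ E] [Nontrivial E]
    [MeasurableSpace E] [BorelSpace E] (μ : Measure E) [μ.IsAddHaarMeasure]
    {f : ℝ → ℝ≥0∞} (hf : Measurable f) {A : Set E} (hA : MeasurableSet A)
    (hcone : ∀ (r : ℝ) (x : E), 0 < r → (r • x ∈ A ↔ x ∈ A)) :
    μ.withDensity (fun x ↦ f ‖x‖) A =
      μ.toSphere (Subtype.val ⁻¹' A) *
        ∫⁻ r : Set.Ioi (0 : ℝ), f r ∂Measure.volumeIoiPow (Module.finrank ℝ E - 1) := by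
  have hB : MeasurableSet (Subtype.val ⁻¹' A : Set (sphere (0 : E) 1)) :=
    measurable_subtype_coe hA
  calc μ.withDensity (fun x ↦ f ‖x‖) A
      = ∫⁻ x, A.indicator (fun x ↦ f ‖x‖) x ∂μ := by
        rw [withDensity_apply _ hA, lintegral_indicator hA]
    _ = ∫⁻ x : ({0}ᶜ : Set E), A.indicator (fun x ↦ f ‖x‖) x ∂(μ.comap (↑)) := by
        rw [lintegral_subtype_comap (measurableSet_singleton _).compl, restrict_compl_singleton]
    _ = ∫⁻ x : ({0}ᶜ : Set E), (fun p : sphere (0 : E) 1 × Set.Ioi (0 : ℝ) ↦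
          (Subtype.val ⁻¹' A : Set (sphere (0 : E) 1)).indicator 1 p.1 * f p.2)
          (homeomorphUnitSphereProd E x) ∂(μ.comap (↑)) := by
        refine lintegral_congr fun x ↦ ?_
        have hx : 0 < ‖(x : E)‖⁻¹ := inv_pos.2 (norm_pos_iff.2 x.2)
        by_cases h : (x : E) ∈ A
        · simp [Set.indicator, h, hcone _ _ hx]
        · simp [Set.indicator, h, hcone _ _ hx]
    _ = ∫⁻ p : sphere (0 : E) 1 × Set.Ioi (0 : ℝ),
          (Subtype.val ⁻¹' A : Set (sphere (0 : E) 1)).indicator 1 p.1 * f p.2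
          ∂(μ.toSphere.prod (.volumeIoiPow (Module.finrank ℝ E - 1))) :=
        μ.measurePreserving_homeomorphUnitSphereProd.lintegral_comp_emb
          (Homeomorph.measurableEmbedding _) fun p : sphere (0 : E) 1 × Set.Ioi (0 : ℝ) ↦
            (Subtype.val ⁻¹' A : Set (sphere (0 : E) 1)).indicator 1 p.1 * f p.2
    _ = _ := by
        rw [lintegral_prod_mul (f := (Subtype.val ⁻¹' A : Set (sphere (0 : E) 1)).indicator 1)
          (g := fun r : Set.Ioi (0 : ℝ) ↦ f r) (measurable_one.indicator hB).aemeasurable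
          (hf.comp measurable_subtype_coe).aemeasurable, lintegral_indicator_one hB]

/-- The standard Gaussian measure has a radial density. -/
theorem stdGaussian_eq_withDensity [InnerProductSpace ℝ E] [FiniteDimensional ℝ E]
    [MeasurableSpace E] [BorelSpace E] :
    stdGaussian E = (volume : Measure E).withDensity (fun x ↦
      ENNReal.ofReal (((2 * Real.pi) ^ ((Module.finrank ℝ E : ℝ) / 2))⁻¹ *
        Real.exp (-(1 / 2) * ‖x‖ ^ 2))) := by
  obtain ⟨K, hK⟩ : ∃ K, K = ((2 * Real.pi) ^ ((Module.finrank ℝ E : ℝ) / 2))⁻¹ := ⟨_, rfl⟩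
  have hKpos : 0 < K := by rw [hK]; positivity
  rw [← hK]
  have hint : Integrable (fun x : E ↦ K * Real.exp (-(1 / 2) * ‖x‖ ^ 2)) := by
    have := GaussianFourier.integrable_cexp_neg_mul_sq_norm_add (V := E) (b := 1 / 2)
      (by norm_num) 0 0
    refine (this.re.const_mul K).congr (.of_forall fun x ↦ ?_)
    have : (-(1 / 2) * (‖x‖ : ℂ) ^ 2) = ((-(1 / 2) * ‖x‖ ^ 2 : ℝ) : ℂ) := by push_cast; ring
    simp only [zero_mul, add_zero, this, RCLike.re_eq_complex_re, Complex.exp_ofReal_re]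
  have : IsFiniteMeasure ((volume : Measure E).withDensity (fun x ↦
      ENNReal.ofReal (K * Real.exp (-(1 / 2) * ‖x‖ ^ 2)))) :=
    isFiniteMeasure_withDensity_ofReal hint.2
  refine Measure.ext_of_charFun (funext fun t ↦ ?_)
  rw [charFun_stdGaussian, charFun_apply,
    integral_withDensity_eq_integral_toReal_smul (by fun_prop) (by simp)]
  have h := GaussianFourier.integral_cexp_neg_mul_sq_norm_add (V := E) (b := 1 / 2)
      (by norm_num) Complex.I t
  have hcongr : ∀ x : E, (ENNReal.ofReal (K * Real.exp (-(1 / 2) * ‖x‖ ^ 2))).toReal •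
      Complex.exp (⟪x, t⟫ * Complex.I) =
      (K : ℂ) * Complex.exp (-(1 / 2) * ‖x‖ ^ 2 + Complex.I * ⟪t, x⟫) := fun x ↦ by
    rw [ENNReal.toReal_ofReal (by positivity), Complex.exp_add, real_inner_comm,
      Complex.real_smul]
    push_cast
    ring_nf
  simp_rw [hcongr, integral_const_mul, h]
  have hpow : ((Real.pi : ℂ) / (1 / 2)) ^ ((Module.finrank ℝ E : ℂ) / 2) = ((K⁻¹ : ℝ) : ℂ) := by
    rw [hK, inv_inv, Complex.ofReal_cpow (by positivity)]
    push_cast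
    congr 1
    ring
  have hK0 : (K : ℂ) ≠ 0 := by
    exact_mod_cast hKpos.ne'
  rw [hpow, ← mul_assoc, Complex.ofReal_inv, mul_inv_cancel₀ hK0, one_mul, Complex.I_sq]
  congr 1
  ring

end Polar

/-- The uniform measure on the sphere agrees with the standard Gaussian measure on cones. -/
theorem sphereMeasure_preimage_cone {n : ℕ} (hn : 1 ≤ n) {A : Set (EuclideanSpace ℝ (Fin n))}
    (hA : MeasurableSet A)
    (hcone : ∀ (r : ℝ) (x : EuclideanSpace ℝ (Fin n)), 0 < r → (r • x ∈ A ↔ x ∈ A)) :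
    sphereMeasure n (Subtype.val ⁻¹' A) = stdGaussian (EuclideanSpace ℝ (Fin n)) A := by
  have : NeZero n := ⟨by omega⟩
  set f : ℝ → ℝ≥0∞ := fun r ↦ ENNReal.ofReal
    (((2 * Real.pi) ^ ((Module.finrank ℝ (EuclideanSpace ℝ (Fin n)) : ℝ) / 2))⁻¹ *
        Real.exp (-(1 / 2) * r ^ 2))
  have hf : Measurable f := by fun_prop
  have hG : stdGaussian (EuclideanSpace ℝ (Fin n)) = volume.withDensity fun x ↦ f ‖x‖ :=
    stdGaussian_eq_withDensity
  have huniv := withDensity_norm_apply_cone (volume : Measure (EuclideanSpace ℝ (Fin n))) hf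
    MeasurableSet.univ (by simp)
  rw [← hG, measure_univ, Set.preimage_univ] at huniv
  rw [hG, withDensity_norm_apply_cone _ hf hA hcone, sphereMeasure, Measure.smul_apply,
    smul_eq_mul, mul_comm, ENNReal.eq_inv_of_mul_eq_one_left ((mul_comm _ _).trans huniv.symm)]

section GaussianProduct

/-- The upper tail of the standard Gaussian distribution is at least Gaussian. -/
theorem exp_div_three_le_gaussianReal_Ici {s : ℝ} (hs : 0 ≤ s) :
    Real.exp (-(s + 1) ^ 2 / 2) / 3 ≤ (gaussianReal 0 1).real (Set.Ici s) := by
  rw [measureReal_def, gaussianReal_apply_eq_integral 0 one_ne_zero,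
    ENNReal.toReal_ofReal (integral_nonneg fun x ↦ gaussianPDFReal_nonneg _ _ _)]
  have hsub : Set.Icc s (s + 1) ⊆ Set.Ici s := Set.Icc_subset_Ici_self
  have hint : Integrable (gaussianPDFReal 0 1) := integrable_gaussianPDFReal 0 1
  have hsqrt : Real.sqrt (2 * Real.pi) ≤ 3 :=
    Real.sqrt_le_iff.2 ⟨by norm_num, by nlinarith [Real.pi_lt_four]⟩
  calc Real.exp (-(s + 1) ^ 2 / 2) / 3
      = ∫ _ in Set.Icc s (s + 1), Real.exp (-(s + 1) ^ 2 / 2) / 3 := by simp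
    _ ≤ ∫ x in Set.Icc s (s + 1), gaussianPDFReal 0 1 x := by
        refine setIntegral_mono_on (by simp) hint.integrableOn measurableSet_Icc fun x hx ↦ ?_
        rw [gaussianPDFReal, div_eq_inv_mul]
        simp only [NNReal.coe_one, mul_one, sub_zero]
        have : 0 < Real.sqrt (2 * Real.pi) := by positivity
        gcongr
        · linarith [hx.1]
        · exact hx.2
    _ ≤ ∫ x in Set.Ici s, gaussianPDFReal 0 1 x :=
        setIntegral_mono_set hint.integrableOn
          (.of_forall fun x ↦ gaussianPDFReal_nonneg _ _ _) hsub.eventuallyLE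

theorem integrable_exp_sq_div_four_gaussianReal :
    Integrable (fun x : ℝ ↦ Real.exp (1 / 4 * x ^ 2)) (gaussianReal 0 1) ∧
      ∫ x, Real.exp (1 / 4 * x ^ 2) ∂gaussianReal 0 1 = Real.sqrt 2 := by
  have hcongr : ∀ x : ℝ, gaussianPDFReal 0 1 x • Real.exp (1 / 4 * x ^ 2) =
      (Real.sqrt (2 * Real.pi))⁻¹ * Real.exp (-(1 / 4) * x ^ 2) := fun x ↦ by
    rw [gaussianPDFReal, smul_eq_mul, mul_assoc, ← Real.exp_add]
    simp only [NNReal.coe_one, mul_one, sub_zero]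
    ring_nf
  constructor
  · rw [gaussianReal_of_var_ne_zero _ one_ne_zero,
      integrable_withDensity_iff_integrable_smul' (measurable_gaussianPDF 0 1)
        (.of_forall fun _ ↦ gaussianPDF_lt_top)]
    simp_rw [toReal_gaussianPDF, hcongr]
    exact (integrable_exp_neg_mul_sq (by norm_num)).const_mul _
  · rw [integral_gaussianReal_eq_integral_smul one_ne_zero]
    simp_rw [hcongr, integral_const_mul, integral_gaussian]
    rw [← Real.sqrt_inv, ← Real.sqrt_mul (by positivity)]
    congr 1
    field_simp
    norm_num

variable {ι : Type*} [Fintype ι]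

/-- The squared norm of a standard Gaussian vector is rarely four times its expectation. -/
theorem pi_gaussianReal_four_mul_card_le_sum_sq (S : Finset ι) :
    (Measure.pi fun _ : ι ↦ gaussianReal 0 1).real {x | 4 * (S.card : ℝ) ≤ ∑ i ∈ S, x i ^ 2} ≤
      Real.exp (-(S.card : ℝ) / 2) := by
  set μ : Measure (ι → ℝ) := Measure.pi fun _ : ι ↦ gaussianReal 0 1
  let X : ι → (ι → ℝ) → ℝ := fun i x ↦ x i ^ 2
  have hind : iIndepFun X μ :=
    iIndepFun_pi (X := fun _ (y : ℝ) ↦ y ^ 2) fun _ ↦ by fun_prop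
  have hmeas : ∀ i, Measurable (X i) := fun i ↦ by fun_prop
  have hmp : ∀ i, MeasurePreserving (Function.eval i) μ (gaussianReal 0 1) :=
    fun i ↦ measurePreserving_eval _ i
  have hint : ∀ i ∈ S, Integrable (fun x ↦ Real.exp (1 / 4 * X i x)) μ := fun i _ ↦
    (hmp i).integrable_comp_of_integrable integrable_exp_sq_div_four_gaussianReal.1
  have hmgf : ∀ i, mgf (X i) μ (1 / 4) = Real.sqrt 2 := fun i ↦ by
    rw [← integrable_exp_sq_div_four_gaussianReal.2, ← (hmp i).map_eq,
      integral_map (hmp i).measurable.aemeasurable (by fun_prop)]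
    rfl
  have h := measure_ge_le_exp_mul_mgf (4 * (S.card : ℝ)) (t := 1 / 4) (by norm_num)
    (hind.integrable_exp_mul_sum hmeas hint)
  rw [hind.mgf_sum hmeas, Finset.prod_congr rfl fun i _ ↦ hmgf i, Finset.prod_const] at h
  have hsqrt : Real.sqrt 2 ≤ Real.exp (1 / 2) := by
    rw [Real.sqrt_le_left (by positivity), ← Real.exp_nat_mul]
    norm_num
    linarith [Real.add_one_le_exp 1]
  calc μ.real {x | 4 * (S.card : ℝ) ≤ ∑ i ∈ S, x i ^ 2}
      ≤ Real.exp (-(1 / 4) * (4 * S.card)) * Real.sqrt 2 ^ S.card := by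
        simpa [X, Finset.sum_apply] using h
    _ ≤ Real.exp (-(1 / 4) * (4 * S.card)) * Real.exp (1 / 2) ^ S.card := by gcongr
    _ = Real.exp (-(S.card : ℝ) / 2) := by
        rw [← Real.exp_nat_mul, ← Real.exp_add]
        ring_nf

/-- Many coordinates of a Gaussian vector exceed a given threshold, with high probability. -/
theorem pi_gaussianReal_card_filter_le (S : Finset ι) (s : ℝ) :
    (Measure.pi fun _ : ι ↦ gaussianReal 0 1).real
      {x | ((S.filter fun i ↦ s ≤ x i).card : ℝ) ≤
        S.card * (gaussianReal 0 1).real (Set.Ici s) / 2} ≤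
      Real.exp (-(S.card * (gaussianReal 0 1).real (Set.Ici s) ^ 2 / 2)) := by
  set μ : Measure (ι → ℝ) := Measure.pi fun _ : ι ↦ gaussianReal 0 1
  set p := (gaussianReal 0 1).real (Set.Ici s)
  let g : ℝ → ℝ := fun y ↦ -(Set.Ici s).indicator 1 y
  have hg : Measurable g := (measurable_one.indicator measurableSet_Ici).neg
  let X : ι → (ι → ℝ) → ℝ := fun i x ↦ g (x i) + p
  have hind : iIndepFun X μ :=
    iIndepFun_pi (X := fun _ (y : ℝ) ↦ g y + p) fun _ ↦ by fun_prop
  have hmp : ∀ i, MeasurePreserving (Function.eval i) μ (gaussianReal 0 1) :=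
    fun i ↦ measurePreserving_eval _ i
  have hmean : ∀ i, ∫ x, g (x i) ∂μ = -p := fun i ↦ by
    have : ∫ y, g y ∂gaussianReal 0 1 = -p := by
      simp only [g, integral_neg, integral_indicator_one measurableSet_Ici, p]
    rw [← this, ← (hmp i).map_eq,
      integral_map (hmp i).measurable.aemeasurable hg.aestronglyMeasurable]
  have hsub : ∀ i ∈ S, HasSubgaussianMGF (X i) (1 / 4) μ := fun i _ ↦ by
    have h := hasSubgaussianMGF_of_mem_Icc (μ := μ) (X := fun x ↦ g (x i)) (a := -1) (b := 0)
      (hg.comp (measurable_pi_apply i)).aemeasurable (.of_forall fun x ↦ by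
        by_cases h : s ≤ x i <;> simp [g, Set.indicator, h])
    simp only [hmean, sub_neg_eq_add] at h
    convert h using 1
    norm_num
  have h := HasSubgaussianMGF.measure_sum_ge_le_of_iIndepFun hind hsub
    (ε := S.card * p / 2) (by positivity)
  have hsum : ∀ x, ∑ i ∈ S, X i x = S.card * p - ((S.filter fun i ↦ s ≤ x i).card : ℝ) := by
    intro x
    simp only [X, g, Finset.sum_add_distrib, Finset.sum_const, Finset.sum_neg_distrib,
      Set.indicator_apply, Set.mem_Ici, Pi.one_apply, Finset.sum_boole, nsmul_eq_mul]
    ring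
  refine (measureReal_mono fun x hx ↦ ?_).trans (h.trans_eq ?_)
  · simp only [Set.mem_ofPred_eq, hsum] at hx ⊢
    linarith
  · congr 1
    rcases S.eq_empty_or_nonempty with rfl | hS
    · simp
    have : (S.card : ℝ) ≠ 0 := by exact_mod_cast hS.card_ne_zero
    simp only [Finset.sum_const, nsmul_eq_mul, NNReal.coe_mul, NNReal.coe_natCast]
    push_cast
    field_simp
    norm_num

end GaussianProduct

/-- If `v i` is nearly `a i i • w i`, a large coordinate of `x` along `w i` forces a large inner
product with `v i`. -/
theorem le_inner_of_le_inner_orthonormal {E : Type*} [NormedAddCommGroup E]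
    [InnerProductSpace ℝ E] {k : ℕ} (hk : 2 ≤ k) {v w : Fin k → E} {a : Fin k → Fin k → ℝ}
    (hw : Orthonormal ℝ w) (ha : ∀ i j : Fin k, j < i → |a i j| < a i i / (k : ℝ) ^ 2)
    (hv : ∀ i, v i = ∑ j ∈ Finset.Iic i, a i j • w j) {x : E} {ρ m : ℝ} (hρ : 0 < ρ)
    (hm : 0 ≤ m) (hx : ‖x‖ ≤ 2 * ρ) (hsum : ∑ i, ⟪w i, x⟫ ^ 2 ≤ 4 * k) {i : Fin k}
    (hi : 0 < i.val) (hg : m / 4 + 1 ≤ ⟪w i, x⟫) :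
    1 / 16 * (‖v i‖ / ρ) * m * ‖x‖ ≤ ⟪v i, x⟫ := by
  have hk' : (2 : ℝ) ≤ k := by exact_mod_cast hk
  have hα : 0 < a i i := by
    have h0 := (abs_nonneg _).trans_lt (ha i ⟨0, by omega⟩ hi)
    have hk2 : (0 : ℝ) < (k : ℝ) ^ 2 := by positivity
    exact (div_pos_iff_of_pos_right hk2).1 h0
  set α := a i i
  have habs : ∑ j, |⟪w j, x⟫| ≤ 2 * k := by
    have h := sq_sum_le_card_mul_sum_sq (s := (Finset.univ : Finset (Fin k)))
      (f := fun j ↦ |⟪w j, x⟫|)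
    simp only [sq_abs, Finset.card_univ, Fintype.card_fin] at h
    refine le_of_sq_le_sq (h.trans ?_) (by positivity)
    nlinarith
  have hsplit : Finset.Iic i = insert i (Finset.Iio i) := (Finset.Iio_insert i).symm
  have hcoef : ∀ j ∈ Finset.Iio i, |a i j| ≤ α / (k : ℝ) ^ 2 := fun j hj ↦
    (ha i j (Finset.mem_Iio.1 hj)).le
  have hinner : α * (⟪w i, x⟫ - 1) ≤ ⟪v i, x⟫ := by
    have hrest : |∑ j ∈ Finset.Iio i, a i j * ⟪w j, x⟫| ≤ α := calc
      |∑ j ∈ Finset.Iio i, a i j * ⟪w j, x⟫|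
          ≤ ∑ j ∈ Finset.Iio i, α / (k : ℝ) ^ 2 * |⟪w j, x⟫| := by
            refine (Finset.abs_sum_le_sum_abs _ _).trans (Finset.sum_le_sum fun j hj ↦ ?_)
            rw [abs_mul]
            exact mul_le_mul_of_nonneg_right (hcoef j hj) (abs_nonneg _)
      _ ≤ ∑ j, α / (k : ℝ) ^ 2 * |⟪w j, x⟫| :=
            Finset.sum_le_sum_of_subset_of_nonneg (Finset.subset_univ _)
              fun _ _ _ ↦ by positivity
      _ ≤ α / (k : ℝ) ^ 2 * (2 * k) := by rw [← Finset.mul_sum]; gcongr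
      _ = α * (2 / k) := by field_simp
      _ ≤ α * 1 := by gcongr; rw [div_le_one (by positivity)]; exact hk'
      _ = α := mul_one α
    rw [hv i, sum_inner, hsplit, Finset.sum_insert (by simp)]
    simp only [real_inner_smul_left]
    linarith [neg_le_of_abs_le hrest]
  have hnorm : ‖v i‖ ≤ 2 * α := calc
    ‖v i‖ ≤ ∑ j ∈ Finset.Iic i, ‖a i j • w j‖ := by rw [hv i]; exact norm_sum_le _ _
    _ = |α| + ∑ j ∈ Finset.Iio i, |a i j| := by
        rw [hsplit, Finset.sum_insert (by simp)]
        simp [norm_smul, hw.1, α]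
    _ ≤ α + ∑ _j ∈ Finset.Iio i, α / (k : ℝ) ^ 2 := by
        rw [abs_of_pos hα]
        gcongr with j hj
        exact hcoef j hj
    _ ≤ α + k * (α / (k : ℝ) ^ 2) := by
        rw [Finset.sum_const, nsmul_eq_mul]
        gcongr
        exact (Finset.card_le_univ _).trans_eq (Fintype.card_fin k)
    _ = α + α * (1 / k) := by field_simp
    _ ≤ α + α * 1 := by gcongr; rw [div_le_one (by positivity)]; linarith
    _ = 2 * α := by ring
  calc 1 / 16 * (‖v i‖ / ρ) * m * ‖x‖ ≤ 1 / 16 * (2 * α / ρ) * m * (2 * ρ) := by gcongr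
    _ = α * (m / 4) := by field_simp; ring
    _ ≤ α * (⟪w i, x⟫ - 1) := by gcongr; linarith
    _ ≤ ⟪v i, x⟫ := hinner

/-- An orthonormal family of `k` vectors in `ℝⁿ` extends to an orthonormal basis. -/
theorem exists_orthonormalBasis_castLE {n k : ℕ} (hkn : k ≤ n)
    {w : Fin k → EuclideanSpace ℝ (Fin n)} (hw : Orthonormal ℝ w) :
    ∃ b : OrthonormalBasis (Fin n) ℝ (EuclideanSpace ℝ (Fin n)),
      ∀ i, b (Fin.castLE hkn i) = w i := by
  have hinj : Function.Injective (Fin.castLE hkn) := Fin.castLE_injective hkn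
  obtain ⟨b, hb⟩ := Orthonormal.exists_orthonormalBasis_extension_of_card_eq
    (𝕜 := ℝ) (ι := Fin n) (by simp) (v := Function.extend (Fin.castLE hkn) w 0)
    (s := Set.range (Fin.castLE hkn)) (by
      let e := Equiv.ofInjective _ hinj
      have he : (Set.range (Fin.castLE hkn)).domRestrict
          (Function.extend (Fin.castLE hkn) w 0) = w ∘ e.symm := by
        funext j
        obtain ⟨i, rfl⟩ := e.surjective j
        simp [e, hinj.extend_apply]
      rw [he]
      exact hw.comp e.symm e.symm.injective)
  exact ⟨b, fun i ↦ (hb _ ⟨i, rfl⟩).trans (hinj.extend_apply _ _ _)⟩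

/-- The vectors `x` for which at least `T` of the inner products with the `v i` exceed
`m / 16` times their typical size `‖v i‖ * ‖x‖ / √n`. -/
def manyLargeInner {n k : ℕ} (v : Fin k → EuclideanSpace ℝ (Fin n)) (m T : ℝ) :
    Set (EuclideanSpace ℝ (Fin n)) :=
  {x | T ≤ ((Finset.univ.filter fun i ↦
    1 / 16 * (‖v i‖ / Real.sqrt n) * m * ‖x‖ ≤ ⟪v i, x⟫).card : ℝ)}

theorem measurableSet_manyLargeInner {n k : ℕ} (v : Fin k → EuclideanSpace ℝ (Fin n)) (m T : ℝ) :
    MeasurableSet (manyLargeInner v m T) := by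
  refine measurableSet_le measurable_const ?_
  simp_rw [Finset.card_filter, Nat.cast_sum]
  refine Finset.measurable_sum _ fun i _ ↦ measurable_from_nat.comp ?_
  exact Measurable.ite (measurableSet_le (by fun_prop) (by fun_prop)) measurable_const
    measurable_const

theorem smul_mem_manyLargeInner {n k : ℕ} (v : Fin k → EuclideanSpace ℝ (Fin n)) (m T : ℝ)
    {r : ℝ} (hr : 0 < r) (x : EuclideanSpace ℝ (Fin n)) :
    r • x ∈ manyLargeInner v m T ↔ x ∈ manyLargeInner v m T := by
  have h : ∀ i, 1 / 16 * (‖v i‖ / Real.sqrt n) * m * ‖r • x‖ ≤ ⟪v i, r • x⟫ ↔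
      1 / 16 * (‖v i‖ / Real.sqrt n) * m * ‖x‖ ≤ ⟪v i, x⟫ := fun i ↦ by
    rw [norm_smul, real_inner_smul_right, Real.norm_of_nonneg hr.le, mul_left_comm,
      mul_le_mul_iff_right₀ hr]
  simp only [manyLargeInner, Set.mem_ofPred_eq, h]

/-- The guaranteed number of large inner products at level `m`. -/
def countThreshold (k : ℕ) (m : ℝ) : ℝ := Real.exp (-(m ^ 2 / 16 + 4)) / 12 * k

theorem exp_neg_card_mul_sq_le {k : ℕ} (hk : 2 ≤ k) {m p : ℝ} (hm : 0 ≤ m)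
    (hmk : m ≤ Real.sqrt (Real.log k) + 1) (hp : Real.exp (-(m ^ 2 / 16 + 4)) / 3 ≤ p) :
    Real.exp (-((k - 1 : ℕ) * p ^ 2 / 2)) ≤ Real.exp (-(Real.exp (-9) / 36 * Real.sqrt k)) := by
  have hk' : (2 : ℝ) ≤ k := by exact_mod_cast hk
  have hlog : 0 ≤ Real.log k := Real.log_nonneg (by linarith)
  have hm2 : m ^ 2 / 8 ≤ Real.log k / 2 + 1 := by
    have h := Real.sq_sqrt hlog
    nlinarith [pow_le_pow_left₀ hm hmk 2, sq_nonneg (Real.sqrt (Real.log k) - 1)]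
  have hsq : Real.exp (-9) / (9 * Real.sqrt k) ≤ p ^ 2 := calc
    Real.exp (-9) / (9 * Real.sqrt k) = Real.exp (-(Real.log k / 2 + 1 + 8)) / 9 := by
      have : Real.exp (-(Real.log k / 2 + 1 + 8)) = Real.exp (-9) / Real.exp (Real.log k / 2) := by
        rw [← Real.exp_sub]; ring_nf
      rw [this, Real.exp_half, Real.exp_log (by linarith), div_div, mul_comm]
    _ ≤ Real.exp (-(m ^ 2 / 8 + 8)) / 9 := by gcongr
    _ = (Real.exp (-(m ^ 2 / 16 + 4)) / 3) ^ 2 := by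
      rw [div_pow, ← Real.exp_nat_mul]; norm_num; ring_nf
    _ ≤ p ^ 2 := by gcongr
  rw [Real.exp_le_exp, neg_le_neg_iff, Nat.cast_sub (by omega), Nat.cast_one]
  have hs : 0 < Real.sqrt k := Real.sqrt_pos.2 (by linarith)
  calc Real.exp (-9) / 36 * Real.sqrt k
      = Real.sqrt k * Real.sqrt k / 2 * (Real.exp (-9) / (9 * Real.sqrt k)) / 2 := by
        field_simp; norm_num
    _ = (k : ℝ) / 2 * (Real.exp (-9) / (9 * Real.sqrt k)) / 2 := by
        rw [Real.mul_self_sqrt (by linarith)]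
    _ ≤ (k - 1) * p ^ 2 / 2 := by
        gcongr ?_ * ?_ / 2
        · linarith
        · linarith

/-- A standard Gaussian vector has many large inner products at all integer levels up to `M`,
outside an event of small probability. -/
theorem stdGaussian_compl_iInter_manyLargeInner_le {n k : ℕ} (hk : 2 ≤ k) (hkn : k ≤ n)
    {v : Fin k → EuclideanSpace ℝ (Fin n)} (hv : InOk k v) {M : ℕ}
    (hM : (M : ℝ) ≤ Real.sqrt (Real.log k) + 1) :
    (stdGaussian (EuclideanSpace ℝ (Fin n))).real
        (⋂ m ∈ Finset.range (M + 1), manyLargeInner v m (countThreshold k m))ᶜ ≤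
      Real.exp (-(n : ℝ) / 2) + Real.exp (-(k : ℝ) / 2) +
        (M + 1) * Real.exp (-(Real.exp (-9) / 36 * Real.sqrt k)) := by
  obtain ⟨w, a, hw, ha, hvw⟩ := hv
  obtain ⟨b, hb⟩ := exists_orthonormalBasis_castLE hkn hw
  have hk' : (2 : ℝ) ≤ k := by exact_mod_cast hk
  have hn' : (0 : ℝ) < n := by exact_mod_cast (show 0 < n by omega)
  set μ : Measure (Fin n → ℝ) := Measure.pi fun _ ↦ gaussianReal 0 1
  let Φ : (Fin n → ℝ) → EuclideanSpace ℝ (Fin n) := fun y ↦ ∑ i, y i • b i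
  have hΦ : Measurable Φ := by fun_prop
  let K : Finset (Fin n) := Finset.univ.map (Fin.castLEEmb hkn)
  let S : Finset (Fin n) :=
    (Finset.univ.filter fun i : Fin k ↦ 0 < i.val).map (Fin.castLEEmb hkn)
  have hK : K.card = k := by simp [K]
  have hS : S.card = k - 1 := by
    have : (Finset.univ.filter fun i : Fin k ↦ 0 < i.val) =
        Finset.univ.erase (⟨0, by omega⟩ : Fin k) := by
      ext i
      simp [Fin.ext_iff, Nat.pos_iff_ne_zero]
    rw [Finset.card_map, this, Finset.card_erase_of_mem (Finset.mem_univ _), Finset.card_univ,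
      Fintype.card_fin]
  let s : ℕ → ℝ := fun m ↦ m / 4 + 1
  let p : ℕ → ℝ := fun m ↦ (gaussianReal 0 1).real (Set.Ici (s m))
  have hp : ∀ m : ℕ, Real.exp (-((m : ℝ) ^ 2 / 16 + 4)) / 3 ≤ p m := fun m ↦ by
    refine le_trans ?_ (exp_div_three_le_gaussianReal_Ici (by positivity))
    gcongr
    simp only [s]
    nlinarith [sq_nonneg ((m : ℝ) / 4 - 2)]
  let B₁ : Set (Fin n → ℝ) :=
    {y | 4 * ((Finset.univ : Finset (Fin n)).card : ℝ) ≤ ∑ i ∈ Finset.univ, y i ^ 2}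
  let B₂ : Set (Fin n → ℝ) := {y | 4 * (K.card : ℝ) ≤ ∑ i ∈ K, y i ^ 2}
  let B₃ : ℕ → Set (Fin n → ℝ) := fun m ↦
    {y | ((S.filter fun i ↦ s m ≤ y i).card : ℝ) ≤ S.card * p m / 2}
  have hsub : Φ ⁻¹' (⋂ m ∈ Finset.range (M + 1), manyLargeInner v m (countThreshold k m))ᶜ ⊆
      B₁ ∪ B₂ ∪ ⋃ m ∈ Finset.range (M + 1), B₃ m := by
    intro y hy
    by_contra hgood
    simp only [Set.mem_union, Set.mem_iUnion, not_or, not_exists] at hgood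
    obtain ⟨⟨h₁, h₂⟩, h₃⟩ := hgood
    refine hy (Set.mem_iInter₂.2 fun m hm ↦ ?_)
    replace h₃ := h₃ m hm
    simp only [B₁, B₂, B₃, Set.mem_ofPred_eq, not_le, hK, hS, Finset.card_univ,
      Fintype.card_fin] at h₁ h₂ h₃
    have hcoord : ∀ j, ⟪b j, Φ y⟫ = y j := fun j ↦ by
      simpa using b.orthonormal.inner_right_fintype y j
    have hwcoord : ∀ i, ⟪w i, Φ y⟫ = y (Fin.castLE hkn i) := fun i ↦ by rw [← hb, hcoord]
    have hnorm : ‖Φ y‖ ≤ 2 * Real.sqrt n := by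
      refine le_of_sq_le_sq ?_ (by positivity)
      rw [← b.sum_sq_norm_inner_right, mul_pow, Real.sq_sqrt hn'.le]
      simp only [hcoord, Real.norm_eq_abs, sq_abs]
      linarith
    have hsum : ∑ i, ⟪w i, Φ y⟫ ^ 2 ≤ 4 * k := by
      simp only [K, Finset.sum_map, Fin.castLEEmb_apply] at h₂
      simp only [hwcoord]
      exact h₂.le
    have hcard : (S.filter fun i ↦ s m ≤ y i).card ≤ (Finset.univ.filter fun i ↦
        1 / 16 * (‖v i‖ / Real.sqrt n) * m * ‖Φ y‖ ≤ ⟪v i, Φ y⟫).card := by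
      rw [Finset.filter_map, Finset.card_map]
      refine Finset.card_le_card fun i hi ↦ ?_
      simp only [Finset.mem_filter, Finset.mem_univ, true_and, Function.comp_apply,
        Fin.castLEEmb_apply] at hi ⊢
      exact le_inner_of_le_inner_orthonormal hk hw ha hvw (by positivity) (by positivity) hnorm
        hsum hi.1 (by rw [hwcoord]; exact hi.2)
    calc countThreshold k m = k / 2 * (Real.exp (-((m : ℝ) ^ 2 / 16 + 4)) / 3) / 2 := by
          rw [countThreshold]; ring
      _ ≤ (k - 1 : ℕ) * p m / 2 := by
          gcongr
          · rw [Nat.cast_sub (by omega), Nat.cast_one]; linarith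
          · exact hp m
      _ ≤ ((S.filter fun i ↦ s m ≤ y i).card : ℝ) := h₃.le
      _ ≤ _ := by exact_mod_cast hcard
  have h₁ : μ.real B₁ ≤ Real.exp (-(n : ℝ) / 2) := by
    have h := pi_gaussianReal_four_mul_card_le_sum_sq (Finset.univ : Finset (Fin n))
    rwa [show -((Finset.univ : Finset (Fin n)).card : ℝ) / 2 = -(n : ℝ) / 2 by simp] at h
  have h₂ : μ.real B₂ ≤ Real.exp (-(k : ℝ) / 2) := by
    have h := pi_gaussianReal_four_mul_card_le_sum_sq K
    rwa [show -(K.card : ℝ) / 2 = -(k : ℝ) / 2 by rw [hK]] at h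
  have h₃ : ∀ m ∈ Finset.range (M + 1),
      μ.real (B₃ m) ≤ Real.exp (-(Real.exp (-9) / 36 * Real.sqrt k)) := fun m hm ↦ by
    refine (pi_gaussianReal_card_filter_le S (s m)).trans ?_
    rw [hS]
    refine exp_neg_card_mul_sq_le hk (Nat.cast_nonneg m) (le_trans ?_ hM) (hp m)
    exact_mod_cast Nat.lt_succ_iff.1 (Finset.mem_range.1 hm)
  rw [stdGaussian_eq_map_pi_orthonormalBasis b, map_measureReal_apply hΦ
    (Finset.measurableSet_biInter _ fun m _ ↦ measurableSet_manyLargeInner _ _ _).compl]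
  calc μ.real (Φ ⁻¹' (⋂ m ∈ Finset.range (M + 1), manyLargeInner v m (countThreshold k m))ᶜ)
      ≤ μ.real (B₁ ∪ B₂ ∪ ⋃ m ∈ Finset.range (M + 1), B₃ m) := measureReal_mono hsub
    _ ≤ μ.real B₁ + μ.real B₂ + ∑ m ∈ Finset.range (M + 1), μ.real (B₃ m) := by
        refine (measureReal_union_le _ _).trans ?_
        gcongr
        · exact measureReal_union_le _ _
        · exact measureReal_biUnion_finset_le _ _
    _ ≤ _ := by
        gcongr
        refine (Finset.sum_le_card_nsmul _ _ _ h₃).trans_eq ?_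
        simp

theorem exp_add_exp_add_mul_exp_le {n k M : ℕ} (hk : 1 ≤ k) (hkn : k ≤ n)
    (hM : (M : ℝ) ≤ Real.sqrt (Real.log k) + 1) {d : ℝ} (hd : 0 < d) (hd1 : d ≤ 1) :
    Real.exp (-(n : ℝ) / 2) + Real.exp (-(k : ℝ) / 2) + (M + 1) * Real.exp (-(d * Real.sqrt k)) ≤
      (2 + 6 / d) * Real.exp (-(d / 2) * Real.sqrt k) := by
  have hk' : (1 : ℝ) ≤ k := by exact_mod_cast hk
  have hn' : (k : ℝ) ≤ n := by exact_mod_cast hkn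
  set x := Real.sqrt k with hx
  have hx1 : 1 ≤ x := Real.one_le_sqrt.2 hk'
  have hxx : x * x = k := Real.mul_self_sqrt (by linarith)
  have hlog : Real.sqrt (Real.log k) ≤ x := Real.sqrt_le_sqrt (Real.log_le_self (by linarith))
  have hkx : d / 2 * x ≤ k / 2 := by nlinarith
  have h₁ : Real.exp (-(n : ℝ) / 2) ≤ Real.exp (-(d / 2) * x) := Real.exp_le_exp.2 (by linarith)
  have h₂ : Real.exp (-(k : ℝ) / 2) ≤ Real.exp (-(d / 2) * x) := Real.exp_le_exp.2 (by linarith)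
  have h₃ : (M + 1) * Real.exp (-(d * x)) ≤ 6 / d * Real.exp (-(d / 2) * x) := calc
    (M + 1) * Real.exp (-(d * x)) ≤ 3 * x * Real.exp (-(d * x)) := by gcongr; linarith
    _ = 6 / d * (d / 2 * x * Real.exp (-(d * x))) := by field_simp; norm_num
    _ ≤ 6 / d * (Real.exp (d / 2 * x) * Real.exp (-(d * x))) := by
        gcongr
        linarith [Real.add_one_le_exp (d / 2 * x)]
    _ = 6 / d * Real.exp (-(d / 2) * x) := by rw [← Real.exp_add]; ring_nf
  linarith

/-- **Lemma 3.3.** There are universal constants `c1, c2, C3, c, C > 0` such that: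
for `1 ≤ k ≤ n` and a fixed tuple `(v_1, …, v_k) ∈ O_k`, there is a subset
`F ⊆ S^{n-1}` with `σ_{n-1}(F) ≥ 1 - C·exp(-c√k)` such that for every `θ ∈ F` and
`0 ≤ t ≤ √(log k)`, at least `c2·e^{-C3 t²}·k` indices `i` satisfy
`⟨v_i, θ⟩ ≥ c1·(|v_i|/√n)·t`. -/
theorem almost_orthogonal_tuple_supergaussian_directions :
    ∃ c1 c2 C3 c C : ℝ, 0 < c1 ∧ 0 < c2 ∧ 0 < C3 ∧ 0 < c ∧ 0 < C ∧
      ∀ (n k : ℕ), 1 ≤ k → k ≤ n →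
      ∀ v : Fin k → EuclideanSpace ℝ (Fin n), InOk k v →
        ∃ F : Set (sphere (0 : EuclideanSpace ℝ (Fin n)) 1),
          ENNReal.ofReal (1 - C * Real.exp (-c * Real.sqrt k)) ≤ sphereMeasure n F ∧
          ∀ θ ∈ F, ∀ t : ℝ, 0 ≤ t → t ≤ Real.sqrt (Real.log k) →
            c2 * Real.exp (-C3 * t ^ 2) * k ≤
              (({i : Fin k |
                c1 * (‖v i‖ / Real.sqrt n) * t ≤
                  ⟪v i, (θ : EuclideanSpace ℝ (Fin n))⟫} : Set (Fin k)).ncard : ℝ) := by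
  obtain ⟨d, hd_def⟩ : ∃ d, d = Real.exp (-9) / 36 := ⟨_, rfl⟩
  have hd : 0 < d := by rw [hd_def]; positivity
  have hd1 : d ≤ 1 := by
    rw [hd_def]
    linarith [Real.exp_le_one_iff.2 (show (-9 : ℝ) ≤ 0 by norm_num)]
  refine ⟨1 / 16, Real.exp (-5) / 12, 1 / 8, d / 2, 2 + 6 / d, by norm_num, by positivity,
    by norm_num, by positivity, by positivity, fun n k hk hkn v hv ↦ ?_⟩
  rcases hk.eq_or_lt with rfl | hk2
  · refine ⟨∅, ?_, by simp⟩
    rw [ENNReal.ofReal_of_nonpos]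
    · exact zero_le
    have h₁ : 0 < 6 / d := by positivity
    have h₂ := Real.add_one_le_exp (-(d / 2))
    simp only [Nat.cast_one, Real.sqrt_one, mul_one]
    nlinarith
  set M := ⌈Real.sqrt (Real.log k)⌉₊
  have hM : (M : ℝ) ≤ Real.sqrt (Real.log k) + 1 := (Nat.ceil_lt_add_one (Real.sqrt_nonneg _)).le
  set A : Set (EuclideanSpace ℝ (Fin n)) :=
    ⋂ m ∈ Finset.range (M + 1), manyLargeInner v m (countThreshold k m) with hA_def
  have hA : MeasurableSet A :=
    Finset.measurableSet_biInter _ fun m _ ↦ measurableSet_manyLargeInner _ _ _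
  refine ⟨Subtype.val ⁻¹' A, ?_, fun θ hθ t ht htk ↦ ?_⟩
  · rw [sphereMeasure_preimage_cone (hk.trans hkn) hA fun r x hr ↦ by
      simp only [hA_def, Set.mem_iInter, smul_mem_manyLargeInner _ _ _ hr]]
    have h₁ := stdGaussian_compl_iInter_manyLargeInner_le hk2 hkn hv hM
    have h₂ := exp_add_exp_add_mul_exp_le hk hkn hM hd hd1
    rw [← hA_def, probReal_compl_eq_one_sub hA, ← hd_def] at h₁
    refine ENNReal.ofReal_le_of_le_toReal ?_
    rw [← measureReal_def]
    linarith
  · set m := ⌈t⌉₊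
    have hmt : (m : ℝ) ≤ t + 1 := (Nat.ceil_lt_add_one ht).le
    have htm : t ≤ m := Nat.le_ceil t
    have hmem : (θ : EuclideanSpace ℝ (Fin n)) ∈ manyLargeInner v m (countThreshold k m) :=
      Set.mem_iInter₂.1 hθ m (Finset.mem_range.2 (Nat.lt_succ_iff.2 (Nat.ceil_le_ceil htk)))
    have hnorm : ‖(θ : EuclideanSpace ℝ (Fin n))‖ = 1 := by simp
    simp only [manyLargeInner, Set.mem_ofPred_eq, hnorm, mul_one] at hmem
    calc Real.exp (-5) / 12 * Real.exp (-(1 / 8) * t ^ 2) * k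
        = Real.exp (-(t ^ 2 / 8 + 5)) / 12 * k := by
          rw [div_mul_eq_mul_div, ← Real.exp_add]; ring_nf
      _ ≤ countThreshold k m := by
          rw [countThreshold]
          gcongr ?_ / 12 * k
          refine Real.exp_le_exp.2 ?_
          nlinarith [sq_nonneg (t - 1), pow_le_pow_left₀ (Nat.cast_nonneg (α := ℝ) m) hmt 2]
      _ ≤ _ := hmem
      _ ≤ _ := by
          rw [← Set.ncard_coe_finset]
          refine Nat.cast_le.2 (Set.ncard_le_ncard (fun i hi ↦ ?_) (Set.toFinite _))
          simp only [Finset.coe_filter, Finset.mem_univ, true_and, Set.mem_ofPred_eq] at hi ⊢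
          exact le_trans (by gcongr) hi
end
end

section
/- There exist universal constants c, C, c1, c2, C3 > 0 such that the following holds. Let n ≥ 1, let θ1, θ2 ∈ S^{n-1} be fixed unit vectors, let X be a random vector in ℝ^n with P(X = 0) = 0 satisfying E⟨X/|X|, θ⟩² ≤ 5/n for all θ ∈ S^{n-1}, and let M > 0 satisfy P(|X| ≥ M) ≥ 1/3 and P(|X| ≤ M) ≥ 2/3. Then there exists a fixed subset F ⊆ S^{n-1} with σ_{n-1}(F) ≥ 1 − C/n^c such that for every θ3 ∈ F, setting θ = (θ1 − θ2 + θ3)/|θ1 − θ2 + θ3|, for all 0 ≤ t ≤ 5·√(log n): min{ P(⟨X, θ⟩ ≥ c1·(M/√n)·t), P(⟨X, θ⟩ ≤ −c1·(M/√n)·t) } ≥ c2·e^{−C3·t²}. -/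
open MeasureTheory Metric
open scoped ENNReal RealInnerProductSpace

noncomputable section

/-- The density of the standard Gaussian measure on `ℝⁿ`, as a function of the norm. -/
def gaussianRadialDensity (n : ℕ) (r : ℝ) : ℝ≥0∞ :=
  ENNReal.ofReal ((2 * Real.pi) ^ (-(n : ℝ) / 2) * Real.exp (-(r ^ 2 / 2)))

lemma measurable_gaussianRadialDensity (n : ℕ) : Measurable (gaussianRadialDensity n) := by
  unfold gaussianRadialDensity; fun_prop

/-- The standard Gaussian measure on `ℝⁿ`, given by its density. -/
def gaussianMeasure (n : ℕ) : Measure (EuclideanSpace ℝ (Fin n)) :=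
  volume.withDensity fun x ↦ gaussianRadialDensity n ‖x‖

lemma lintegral_gaussianMeasure (n : ℕ) {f : EuclideanSpace ℝ (Fin n) → ℝ≥0∞}
    (hf : Measurable f) :
    ∫⁻ x, f x ∂gaussianMeasure n = ∫⁻ x, gaussianRadialDensity n ‖x‖ * f x := by
  rw [gaussianMeasure, lintegral_withDensity_eq_lintegral_mul _ _ hf]
  · rfl
  · exact (measurable_gaussianRadialDensity n).comp measurable_norm

lemma lintegral_exp_neg_mul_sq_norm (n : ℕ) {b : ℝ} (hb : 0 < b) :
    ∫⁻ x : EuclideanSpace ℝ (Fin n), ENNReal.ofReal (Real.exp (-b * ‖x‖ ^ 2)) =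
      ENNReal.ofReal ((Real.pi / b) ^ ((n : ℝ) / 2)) := by
  have h := GaussianFourier.integral_rexp_neg_mul_sq_norm (V := EuclideanSpace ℝ (Fin n)) hb
  rw [finrank_euclideanSpace_fin] at h
  rw [← h, ofReal_integral_eq_lintegral_ofReal]
  · refine Integrable.of_integral_ne_zero ?_
    rw [h]
    positivity
  · exact Filter.Eventually.of_forall fun x ↦ (Real.exp_pos _).le

lemma lintegral_exp_inner_gaussianMeasure (n : ℕ) (v : EuclideanSpace ℝ (Fin n)) :
    ∫⁻ x, ENNReal.ofReal (Real.exp ⟪v, x⟫) ∂gaussianMeasure n =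
      ENNReal.ofReal (Real.exp (‖v‖ ^ 2 / 2)) := by
  rw [lintegral_gaussianMeasure n (by fun_prop)]
  have hpt : ∀ x : EuclideanSpace ℝ (Fin n),
      gaussianRadialDensity n ‖x‖ * ENNReal.ofReal (Real.exp ⟪v, x⟫) =
      ENNReal.ofReal ((2 * Real.pi) ^ (-(n : ℝ) / 2) * Real.exp (‖v‖ ^ 2 / 2)) *
        ENNReal.ofReal (Real.exp (-(1 / 2) * ‖x - v‖ ^ 2)) := by
    intro x
    rw [gaussianRadialDensity, ← ENNReal.ofReal_mul (by positivity),
      ← ENNReal.ofReal_mul (by positivity), mul_assoc, mul_assoc, ← Real.exp_add,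
      ← Real.exp_add, norm_sub_sq_real, real_inner_comm]
    congr 3
    ring
  simp_rw [hpt]
  rw [lintegral_const_mul _ (by fun_prop),
    lintegral_sub_right_eq_self (fun x ↦ ENNReal.ofReal (Real.exp (-(1 / 2) * ‖x‖ ^ 2))) v,
    lintegral_exp_neg_mul_sq_norm n (by norm_num), ← ENNReal.ofReal_mul (by positivity)]
  congr 1
  have : Real.pi / (1 / 2) = 2 * Real.pi := by ring
  rw [this, mul_right_comm, ← Real.rpow_add (by positivity)]
  simp [neg_div]

instance isProbabilityMeasure_gaussianMeasure (n : ℕ) :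
    IsProbabilityMeasure (gaussianMeasure n) where
  measure_univ := by simpa using lintegral_exp_inner_gaussianMeasure n 0

lemma lintegral_exp_sq_norm_gaussianMeasure (n : ℕ) :
    ∫⁻ x, ENNReal.ofReal (Real.exp (‖x‖ ^ 2 / 4)) ∂gaussianMeasure n =
      ENNReal.ofReal (2 ^ ((n : ℝ) / 2)) := by
  rw [lintegral_gaussianMeasure n (by fun_prop)]
  have hpt : ∀ x : EuclideanSpace ℝ (Fin n),
      gaussianRadialDensity n ‖x‖ * ENNReal.ofReal (Real.exp (‖x‖ ^ 2 / 4)) =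
      ENNReal.ofReal ((2 * Real.pi) ^ (-(n : ℝ) / 2)) *
        ENNReal.ofReal (Real.exp (-(1 / 4) * ‖x‖ ^ 2)) := by
    intro x
    rw [gaussianRadialDensity, ← ENNReal.ofReal_mul (by positivity),
      ← ENNReal.ofReal_mul (by positivity), mul_assoc, ← Real.exp_add]
    congr 3
    ring
  simp_rw [hpt]
  rw [lintegral_const_mul _ (by fun_prop), lintegral_exp_neg_mul_sq_norm n (by norm_num),
    ← ENNReal.ofReal_mul (by positivity)]
  congr 1
  have : Real.pi / (1 / 4) = 2 * (2 * Real.pi) := by ring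
  rw [this, Real.mul_rpow (x := 2) (y := 2 * Real.pi) (by norm_num) (by positivity), mul_left_comm,
    ← Real.rpow_add (by positivity)]
  simp [neg_div]

lemma gaussianMeasure_norm_gt_le (n : ℕ) :
    gaussianMeasure n {x | 3 * Real.sqrt n < ‖x‖} ≤ ENNReal.ofReal (Real.exp (-n)) := by
  calc gaussianMeasure n {x | 3 * Real.sqrt n < ‖x‖}
      ≤ gaussianMeasure n {x | ENNReal.ofReal (Real.exp (9 * n / 4)) ≤
          ENNReal.ofReal (Real.exp (‖x‖ ^ 2 / 4))} := by
        refine measure_mono fun x hx ↦ ?_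
        simp only [Set.mem_ofPred_eq] at hx ⊢
        gcongr
        nlinarith [Real.sq_sqrt (Nat.cast_nonneg (α := ℝ) n), Real.sqrt_nonneg (n : ℝ)]
    _ ≤ (∫⁻ x, ENNReal.ofReal (Real.exp (‖x‖ ^ 2 / 4)) ∂gaussianMeasure n) /
          ENNReal.ofReal (Real.exp (9 * n / 4)) :=
        meas_ge_le_lintegral_div (by fun_prop) (by simp [Real.exp_pos]) ENNReal.ofReal_ne_top
    _ ≤ ENNReal.ofReal (Real.exp (-n)) := by
        rw [lintegral_exp_sq_norm_gaussianMeasure, ← ENNReal.ofReal_div_of_pos (Real.exp_pos _)]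
        gcongr
        rw [div_le_iff₀ (Real.exp_pos _), ← Real.exp_add]
        calc (2 : ℝ) ^ ((n : ℝ) / 2) ≤ (Real.exp 1) ^ ((n : ℝ) / 2) := by
              gcongr
              linarith [Real.add_one_le_exp (1 : ℝ)]
          _ = Real.exp (n / 2) := by rw [← Real.exp_mul, one_mul]
          _ ≤ _ := by
            gcongr
            linarith [Nat.cast_nonneg (α := ℝ) n]

lemma gaussianMeasure_image_cone (n : ℕ) {s : Set (sphere (0 : EuclideanSpace ℝ (Fin n)) 1)}
    (hs : MeasurableSet s) :
    gaussianMeasure n (Subtype.val '' (homeomorphUnitSphereProd _ ⁻¹' s ×ˢ Set.univ)) =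
      (volume : Measure (EuclideanSpace ℝ (Fin n))).toSphere s *
        ∫⁻ r : Set.Ioi (0 : ℝ), gaussianRadialDensity n r ∂Measure.volumeIoiPow (n - 1) := by
  have hm : MeasurableSet (homeomorphUnitSphereProd (EuclideanSpace ℝ (Fin n)) ⁻¹'
      s ×ˢ Set.univ) := (homeomorphUnitSphereProd _).measurable (hs.prod .univ)
  have h0 : MeasurableSet ({0}ᶜ : Set (EuclideanSpace ℝ (Fin n))) :=
    (measurableSet_singleton _).compl
  have hg := measurable_gaussianRadialDensity n
  have key :=
    (volume : Measure (EuclideanSpace ℝ (Fin n))).measurePreserving_homeomorphUnitSphereProd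
  rw [finrank_euclideanSpace_fin] at key
  have h2 := key.setLIntegral_comp_preimage_emb (Homeomorph.measurableEmbedding _)
    (fun p ↦ gaussianRadialDensity n p.2) (s ×ˢ Set.univ)
  simp only [homeomorphUnitSphereProd_apply_snd_coe] at h2
  rw [gaussianMeasure, withDensity_apply _ (h0.subtype_image hm),
    ← setLIntegral_subtype h0 _ (fun x ↦ gaussianRadialDensity n ‖x‖), h2,
    ← Measure.prod_restrict, Measure.restrict_univ,
    lintegral_prod _ (by fun_prop)]
  simp only [lintegral_const, Measure.restrict_apply_univ, mul_comm]

lemma gaussianMeasure_le_sphereMeasure (n : ℕ) (hn : 1 ≤ n) {S : Set (EuclideanSpace ℝ (Fin n))}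
    {F : Set (sphere (0 : EuclideanSpace ℝ (Fin n)) 1)}
    (h : ∀ x ∈ S, x ≠ 0 → ∀ u : sphere (0 : EuclideanSpace ℝ (Fin n)) 1,
      (u : EuclideanSpace ℝ (Fin n)) = ‖x‖⁻¹ • x → u ∈ F) :
    gaussianMeasure n S ≤ sphereMeasure n F := by
  have : NeZero n := ⟨by omega⟩
  have hz : gaussianMeasure n {0} = 0 :=
    withDensity_absolutelyContinuous _ _ (measure_singleton _)
  set K := ∫⁻ r : Set.Ioi (0 : ℝ), gaussianRadialDensity n r ∂Measure.volumeIoiPow (n - 1)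
    with hK
  set τ := (volume : Measure (EuclideanSpace ℝ (Fin n))).toSphere with hτ
  have huniv : τ Set.univ * K = 1 := by
    rw [hτ, hK, ← gaussianMeasure_image_cone n MeasurableSet.univ, Set.univ_prod_univ,
      Set.preimage_univ, Set.image_univ, Subtype.range_coe, prob_compl_eq_one_sub
      (measurableSet_singleton _), hz, tsub_zero]
  have hK' : K = (τ Set.univ)⁻¹ := ENNReal.eq_inv_of_mul_eq_one_left (by rwa [mul_comm])
  calc gaussianMeasure n S
      ≤ gaussianMeasure n (Subtype.val ''
          (homeomorphUnitSphereProd _ ⁻¹' toMeasurable τ F ×ˢ Set.univ) ∪ {0}) := by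
        refine measure_mono fun x hx ↦ ?_
        by_cases hx0 : x = 0
        · exact Or.inr hx0
        · refine Or.inl ⟨⟨x, hx0⟩, ⟨subset_toMeasurable _ _ (h x hx hx0 _ ?_), trivial⟩, rfl⟩
          simp
    _ ≤ τ (toMeasurable τ F) * K + 0 := by
        rw [← hz, hτ, hK, ← gaussianMeasure_image_cone n (measurableSet_toMeasurable _ _)]
        exact measure_union_le _ _
    _ = sphereMeasure n F := by
        rw [measure_toMeasurable, add_zero, hK', sphereMeasure, Measure.smul_apply, smul_eq_mul,
          mul_comm]

section LaplaceTransform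

variable {Ω : Type*} [MeasurableSpace Ω] {μ : Measure Ω} {n : ℕ}
  {V W : Ω → EuclideanSpace ℝ (Fin n)}

/-- The Laplace transform of the random vector `V`. -/
def laplaceTransform (μ : Measure Ω) (V : Ω → EuclideanSpace ℝ (Fin n))
    (x : EuclideanSpace ℝ (Fin n)) : ℝ :=
  ∫ ω, Real.exp ⟪V ω, x⟫ ∂μ

lemma laplaceTransform_nonneg (x : EuclideanSpace ℝ (Fin n)) : 0 ≤ laplaceTransform μ V x :=
  integral_nonneg fun _ ↦ (Real.exp_pos _).le

variable [IsFiniteMeasure μ]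

lemma integrable_exp_inner (hV : Measurable V) {R : ℝ} (hR : ∀ᵐ ω ∂μ, ‖V ω‖ ≤ R)
    (x : EuclideanSpace ℝ (Fin n)) : Integrable (fun ω ↦ Real.exp ⟪V ω, x⟫) μ := by
  refine Integrable.of_bound (by fun_prop) (Real.exp (R * ‖x‖)) ?_
  filter_upwards [hR] with ω hω
  rw [Real.norm_eq_abs, Real.abs_exp]
  gcongr
  exact (real_inner_le_norm _ _).trans (by gcongr)

lemma ofReal_laplaceTransform (hV : Measurable V) {R : ℝ} (hR : ∀ᵐ ω ∂μ, ‖V ω‖ ≤ R)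
    (x : EuclideanSpace ℝ (Fin n)) :
    ENNReal.ofReal (laplaceTransform μ V x) = ∫⁻ ω, ENNReal.ofReal (Real.exp ⟪V ω, x⟫) ∂μ :=
  ofReal_integral_eq_lintegral_ofReal (integrable_exp_inner hV hR x)
    (Filter.Eventually.of_forall fun _ ↦ (Real.exp_pos _).le)

lemma stronglyMeasurable_laplaceTransform (hV : Measurable V) :
    StronglyMeasurable (laplaceTransform μ V) := by
  have : StronglyMeasurable (fun p : EuclideanSpace ℝ (Fin n) × Ω ↦ Real.exp ⟪V p.2, p.1⟫) := by
    apply Measurable.stronglyMeasurable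
    fun_prop
  exact this.integral_prod_right

lemma lintegral_laplaceTransform (hV : Measurable V) {R : ℝ} (hR : ∀ᵐ ω ∂μ, ‖V ω‖ ≤ R) :
    ∫⁻ x, ENNReal.ofReal (laplaceTransform μ V x) ∂gaussianMeasure n =
      ∫⁻ ω, ENNReal.ofReal (Real.exp (‖V ω‖ ^ 2 / 2)) ∂μ := by
  simp_rw [ofReal_laplaceTransform hV hR]
  rw [lintegral_lintegral_swap (by fun_prop)]
  simp_rw [lintegral_exp_inner_gaussianMeasure]

lemma lintegral_laplaceTransform_sq (hV : Measurable V) {R : ℝ} (hR : ∀ᵐ ω ∂μ, ‖V ω‖ ≤ R) :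
    ∫⁻ x, ENNReal.ofReal (laplaceTransform μ V x ^ 2) ∂gaussianMeasure n =
      ∫⁻ ω, ∫⁻ ω', ENNReal.ofReal (Real.exp (‖V ω + V ω'‖ ^ 2 / 2)) ∂μ ∂μ := by
  have hsq : ∀ x, ENNReal.ofReal (laplaceTransform μ V x ^ 2) =
      ∫⁻ ω, ∫⁻ ω', ENNReal.ofReal (Real.exp ⟪V ω + V ω', x⟫) ∂μ ∂μ := by
    intro x
    rw [ENNReal.ofReal_pow (laplaceTransform_nonneg x), ofReal_laplaceTransform hV hR, sq,
      ← lintegral_mul_const _ (by fun_prop)]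
    refine lintegral_congr fun ω ↦ ?_
    rw [← lintegral_const_mul _ (by fun_prop)]
    refine lintegral_congr fun ω' ↦ ?_
    rw [← ENNReal.ofReal_mul (Real.exp_pos _).le, ← Real.exp_add, inner_add_left]
  simp_rw [hsq]
  rw [lintegral_lintegral_swap]
  · refine lintegral_congr fun ω ↦ ?_
    rw [lintegral_lintegral_swap (by fun_prop)]
    simp_rw [lintegral_exp_inner_gaussianMeasure]
  · apply Measurable.aemeasurable
    exact Measurable.lintegral_prod_right'
      (f := fun q : (EuclideanSpace ℝ (Fin n) × Ω) × Ω ↦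
        ENNReal.ofReal (Real.exp ⟪V q.1.2 + V q.2, q.1.1⟫)) (by fun_prop)

lemma exp_mul_le_one_add {a ε c : ℝ} (ha : 0 ≤ a) (hε : |ε| ≤ 1) (hc : 0 < c) :
    Real.exp (a * ε) ≤ 1 + a * Real.exp a * ((c * ε ^ 2 + c⁻¹) / 2) := by
  have h1 : Real.exp (a * ε) ≤ 1 + a * |ε| * Real.exp a := by
    have h2 : a * ε ≤ a * |ε| := by gcongr; exact le_abs_self ε
    have h3 : a * |ε| ≤ a := mul_le_of_le_one_right ha hε
    have h4 := Real.add_one_le_exp (-(a * |ε|))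
    have h5 : Real.exp (a * |ε|) - 1 ≤ a * |ε| * Real.exp (a * |ε|) := by
      have h6 : Real.exp (a * |ε|) * Real.exp (-(a * |ε|)) = 1 := by
        rw [← Real.exp_add]; simp
      nlinarith [Real.exp_pos (a * |ε|)]
    have h7 : a * |ε| * Real.exp (a * |ε|) ≤ a * |ε| * Real.exp a := by gcongr
    linarith [Real.exp_le_exp.2 h2]
  have h8 : |ε| ≤ (c * ε ^ 2 + c⁻¹) / 2 := by
    have : c * ε ^ 2 + c⁻¹ - 2 * |ε| = c⁻¹ * (c * |ε| - 1) ^ 2 := by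
      rw [← sq_abs ε]; field_simp; ring
    have : 0 ≤ c⁻¹ * (c * |ε| - 1) ^ 2 := by positivity
    linarith
  have h9 : a * Real.exp a * |ε| ≤ a * Real.exp a * ((c * ε ^ 2 + c⁻¹) / 2) := by gcongr
  linarith

lemma lintegral_laplaceTransform_of_norm_eq_one (hW : Measurable W)
    (hW1 : ∀ᵐ ω ∂μ, ‖W ω‖ = 1) (a : ℝ) :
    ∫⁻ x, ENNReal.ofReal (laplaceTransform μ (fun ω ↦ a • W ω) x) ∂gaussianMeasure n =
      ENNReal.ofReal (μ.real Set.univ * Real.exp (a ^ 2 / 2)) := by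
  rw [lintegral_laplaceTransform (R := |a|) (by fun_prop)]
  · calc _ = ∫⁻ ω, ENNReal.ofReal (Real.exp (a ^ 2 / 2)) ∂μ := by
          refine lintegral_congr_ae ?_
          filter_upwards [hW1] with ω hω
          simp [norm_smul, hω]
      _ = _ := by
        rw [lintegral_const, mul_comm, ENNReal.ofReal_mul measureReal_nonneg,
          ofReal_measureReal]
  · filter_upwards [hW1] with ω hω
    simp [norm_smul, hω]

lemma lintegral_laplaceTransform_sq_le (hn : 1 ≤ n) (hW : Measurable W)
    (hW1 : ∀ᵐ ω ∂μ, ‖W ω‖ = 1) (hμ : μ.real Set.univ ≤ 1)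
    (hcov : ∀ θ : EuclideanSpace ℝ (Fin n), ‖θ‖ = 1 → ∫ ω, ⟪W ω, θ⟫ ^ 2 ∂μ ≤ 5 / n) (a : ℝ) :
    ∫⁻ x, ENNReal.ofReal (laplaceTransform μ (fun ω ↦ a • W ω) x ^ 2) ∂gaussianMeasure n ≤
      ENNReal.ofReal (μ.real Set.univ ^ 2 * Real.exp (a ^ 2) +
        3 * a ^ 2 * Real.exp (2 * a ^ 2) / Real.sqrt n) := by
  have hs : 0 < Real.sqrt n := by positivity
  set p := μ.real Set.univ with hp
  have hp0 : 0 ≤ p := measureReal_nonneg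
  set B := a ^ 2 * Real.exp (a ^ 2) with hB
  have hB0 : 0 ≤ B := by positivity
  rw [lintegral_laplaceTransform_sq (R := |a|) (by fun_prop)]
  swap
  · filter_upwards [hW1] with ω hω
    simp [norm_smul, hω]
  have inner_bound : ∀ ω, ‖W ω‖ = 1 →
      ∫⁻ ω', ENNReal.ofReal (Real.exp (‖a • W ω + a • W ω'‖ ^ 2 / 2)) ∂μ ≤
        ENNReal.ofReal (Real.exp (a ^ 2) * (p + 3 * B / Real.sqrt n)) := by
    intro ω hω
    have hint : Integrable (fun ω' ↦ ⟪W ω', W ω⟫ ^ 2) μ := by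
      refine Integrable.of_bound (by fun_prop) 1 ?_
      filter_upwards [hW1] with ω' hω'
      have := abs_real_inner_le_norm (W ω') (W ω)
      rw [hω, hω', mul_one] at this
      rw [Real.norm_eq_abs, abs_pow]
      exact pow_le_one₀ (abs_nonneg _) this
    calc _ ≤ ∫⁻ ω', ENNReal.ofReal (Real.exp (a ^ 2) *
            (1 + B * ((Real.sqrt n * ⟪W ω', W ω⟫ ^ 2 + (Real.sqrt n)⁻¹) / 2))) ∂μ := by
          refine lintegral_mono_ae ?_
          filter_upwards [hW1] with ω' hω'
          have := abs_real_inner_le_norm (W ω') (W ω)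
          rw [hω, hω', mul_one] at this
          have hexp := exp_mul_le_one_add (sq_nonneg a) this hs
          gcongr
          rw [← smul_add, norm_smul, mul_pow, Real.norm_eq_abs, sq_abs, norm_add_sq_real, hω, hω',
            real_inner_comm]
          calc _ = Real.exp (a ^ 2) * Real.exp (a ^ 2 * ⟪W ω', W ω⟫) := by
                rw [← Real.exp_add]; congr 1; ring
            _ ≤ _ := by gcongr
      _ = ENNReal.ofReal (∫ ω', Real.exp (a ^ 2) *
            (1 + B * ((Real.sqrt n * ⟪W ω', W ω⟫ ^ 2 + (Real.sqrt n)⁻¹) / 2)) ∂μ) := by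
          rw [ofReal_integral_eq_lintegral_ofReal]
          · exact ((integrable_const _).add ((((hint.const_mul _).add
              (integrable_const _)).div_const _).const_mul _)).const_mul _
          · exact Filter.Eventually.of_forall fun ω' ↦ by positivity
      _ ≤ _ := by
          gcongr
          rw [integral_const_mul]
          gcongr
          have : ∀ ω', 1 + B * ((Real.sqrt n * ⟪W ω', W ω⟫ ^ 2 + (Real.sqrt n)⁻¹) / 2) =
              (1 + B * (Real.sqrt n)⁻¹ / 2) + B * Real.sqrt n / 2 * ⟪W ω', W ω⟫ ^ 2 :=
            fun ω' ↦ by ring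
          simp_rw [this]
          rw [integral_add (integrable_const _) (hint.const_mul _), integral_const,
            integral_const_mul, smul_eq_mul, ← hp]
          have hc := hcov (W ω) hω
          have hn' : (5 : ℝ) / n = 5 / (Real.sqrt n * Real.sqrt n) := by
            rw [Real.mul_self_sqrt (by positivity)]
          calc _ ≤ p * (1 + B * (Real.sqrt n)⁻¹ / 2) + B * Real.sqrt n / 2 * (5 / n) := by gcongr
            _ ≤ p + 1 * (B * (Real.sqrt n)⁻¹ / 2) + B * Real.sqrt n / 2 * (5 / n) := by
                rw [mul_add, mul_one]; gcongr
            _ = _ := by rw [hn']; field_simp; ring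
  calc _ ≤ ∫⁻ ω, ENNReal.ofReal (Real.exp (a ^ 2) * (p + 3 * B / Real.sqrt n)) ∂μ := by
        refine lintegral_mono_ae ?_
        filter_upwards [hW1] with ω hω using inner_bound ω hω
    _ = ENNReal.ofReal (p * (Real.exp (a ^ 2) * (p + 3 * B / Real.sqrt n))) := by
        rw [lintegral_const, mul_comm, ENNReal.ofReal_mul hp0, hp, ofReal_measureReal]
    _ ≤ _ := by
        gcongr
        have : Real.exp (2 * a ^ 2) = Real.exp (a ^ 2) * Real.exp (a ^ 2) := by
          rw [← Real.exp_add]; ring_nf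
        rw [this]
        calc _ = p ^ 2 * Real.exp (a ^ 2) +
              p * (Real.exp (a ^ 2) * (3 * B / Real.sqrt n)) := by ring
          _ ≤ p ^ 2 * Real.exp (a ^ 2) + 1 * (Real.exp (a ^ 2) * (3 * B / Real.sqrt n)) := by
              gcongr
          _ = _ := by rw [hB]; ring

lemma gaussianMeasure_laplaceTransform_deviation_le (hn : 1 ≤ n) (hW : Measurable W)
    (hW1 : ∀ᵐ ω ∂μ, ‖W ω‖ = 1) (hμ : μ.real Set.univ ≤ 1) (hμ' : 1 / 6 ≤ μ.real Set.univ)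
    (hcov : ∀ θ : EuclideanSpace ℝ (Fin n), ‖θ‖ = 1 → ∫ ω, ⟪W ω, θ⟫ ^ 2 ∂μ ≤ 5 / n) (a : ℝ) :
    gaussianMeasure n {x | μ.real Set.univ * Real.exp (a ^ 2 / 2) / 4 ≤
        |laplaceTransform μ (fun ω ↦ a • W ω) x - μ.real Set.univ * Real.exp (a ^ 2 / 2)|} ≤
      ENNReal.ofReal (1728 * Real.exp (2 * a ^ 2) / Real.sqrt n) := by
  set L := laplaceTransform μ (fun ω ↦ a • W ω) with hL
  set p := μ.real Set.univ with hp
  have hp0 : 0 < p := by linarith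
  have hs : 0 < Real.sqrt n := by positivity
  have hm : StronglyMeasurable L := stronglyMeasurable_laplaceTransform (by fun_prop)
  have h0 : ∀ x, 0 ≤ L x := laplaceTransform_nonneg
  have h1 : ∫ x, L x ∂gaussianMeasure n = p * Real.exp (a ^ 2 / 2) := by
    rw [integral_eq_lintegral_of_nonneg_ae (Filter.Eventually.of_forall h0)
      hm.aestronglyMeasurable, lintegral_laplaceTransform_of_norm_eq_one hW hW1,
      ENNReal.toReal_ofReal (by positivity)]
  have hle := lintegral_laplaceTransform_sq_le hn hW hW1 hμ hcov a
  have hsq : Integrable (fun x ↦ L x ^ 2) (gaussianMeasure n) := by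
    refine ⟨(hm.pow 2).aestronglyMeasurable, ?_⟩
    rw [hasFiniteIntegral_iff_ofReal (Filter.Eventually.of_forall fun x ↦ sq_nonneg _)]
    exact hle.trans_lt ENNReal.ofReal_lt_top
  have hmem : MemLp L 2 (gaussianMeasure n) :=
    (memLp_two_iff_integrable_sq hm.aestronglyMeasurable).2 hsq
  have h2 : ∫ x, L x ^ 2 ∂gaussianMeasure n ≤ p ^ 2 * Real.exp (a ^ 2) +
        3 * a ^ 2 * Real.exp (2 * a ^ 2) / Real.sqrt n := by
    rw [integral_eq_lintegral_of_nonneg_ae (Filter.Eventually.of_forall fun x ↦ sq_nonneg _)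
      (hm.pow 2).aestronglyMeasurable]
    exact ENNReal.toReal_le_of_le_ofReal (by positivity) hle
  have hc : 0 < p * Real.exp (a ^ 2 / 2) / 4 := by positivity
  have hcheb := ProbabilityTheory.meas_ge_le_variance_div_sq hmem hc
  rw [h1] at hcheb
  refine hcheb.trans (ENNReal.ofReal_le_ofReal ?_)
  have he : Real.exp (a ^ 2 / 2) ^ 2 = Real.exp (a ^ 2) := by
    rw [← Real.exp_nat_mul]; congr 1; push_cast; ring
  have he2 : Real.exp (2 * a ^ 2) = Real.exp (a ^ 2) * Real.exp (a ^ 2) := by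
    rw [← Real.exp_add]; ring_nf
  have hvar : ProbabilityTheory.variance L (gaussianMeasure n) ≤
      3 * a ^ 2 * Real.exp (2 * a ^ 2) / Real.sqrt n := by
    rw [ProbabilityTheory.variance_eq_sub hmem, h1, mul_pow, he]
    simp only [Pi.pow_apply]
    linarith
  rw [div_le_iff₀ (by positivity)]
  refine hvar.trans ?_
  have hea : a ^ 2 ≤ Real.exp (a ^ 2) := by linarith [Real.add_one_le_exp (a ^ 2)]
  have hp2 : 1 / 36 ≤ p ^ 2 := by nlinarith
  calc 3 * a ^ 2 * Real.exp (2 * a ^ 2) / Real.sqrt n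
      ≤ 3 * Real.exp (a ^ 2) * Real.exp (2 * a ^ 2) / Real.sqrt n := by gcongr
    _ = 108 * Real.exp (2 * a ^ 2) / Real.sqrt n * ((1 / 36) * Real.exp (a ^ 2)) := by ring
    _ ≤ 108 * Real.exp (2 * a ^ 2) / Real.sqrt n * (p ^ 2 * Real.exp (a ^ 2)) := by gcongr
    _ = _ := by rw [div_pow, mul_pow, he]; ring


/-- A Paley–Zygmund type lower bound for a tail in terms of the Laplace transform. -/
lemma exp_neg_sq_le_measureReal_tail {Y : Ω → ℝ} (hY : Measurable Y) {p k : ℝ} (hk : 2 ≤ k)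
    (h1 : Integrable (fun ω ↦ Real.exp (k * Y ω)) μ)
    (h2 : Integrable (fun ω ↦ Real.exp (2 * k * Y ω)) μ)
    (hp : μ.real Set.univ = p)
    (hlow : 3 / 4 * p * Real.exp (k ^ 2 / 2) ≤ ∫ ω, Real.exp (k * Y ω) ∂μ)
    (hup : ∫ ω, Real.exp (2 * k * Y ω) ∂μ ≤ 5 / 4 * p * Real.exp ((2 * k) ^ 2 / 2)) :
    p / 20 * Real.exp (-k ^ 2) ≤ μ.real {ω | k / 4 ≤ Y ω} := by
  have hp0 : 0 ≤ p := hp ▸ measureReal_nonneg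
  set S := {ω | k / 4 ≤ Y ω} with hS
  have hSm : MeasurableSet S := measurableSet_le measurable_const hY
  set η := Real.exp (-(3 * k ^ 2 / 2)) / 10 with hη
  have hη0 : 0 < η := by positivity
  have hpt : ∀ ω, Real.exp (k * Y ω) ≤
      Real.exp (k ^ 2 / 4) + η * Real.exp (2 * k * Y ω) + (4 * η)⁻¹ * S.indicator 1 ω := by
    intro ω
    by_cases hω : ω ∈ S
    · have hsq : Real.exp (2 * k * Y ω) = Real.exp (k * Y ω) ^ 2 := by
        rw [← Real.exp_nat_mul]; congr 1; push_cast; ring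
      rw [Set.indicator_of_mem hω, hsq, Pi.one_apply, mul_one]
      have : η * Real.exp (k * Y ω) ^ 2 + (4 * η)⁻¹ - Real.exp (k * Y ω) =
          (4 * η)⁻¹ * (2 * η * Real.exp (k * Y ω) - 1) ^ 2 := by
        field_simp; ring
      have : 0 ≤ (4 * η)⁻¹ * (2 * η * Real.exp (k * Y ω) - 1) ^ 2 := by positivity
      linarith [Real.exp_pos (k ^ 2 / 4)]
    · rw [Set.indicator_of_notMem hω, mul_zero, add_zero]
      have hlt : Y ω < k / 4 := not_le.1 hω
      have : Real.exp (k * Y ω) ≤ Real.exp (k ^ 2 / 4) := by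
        gcongr
        nlinarith
      have : 0 ≤ η * Real.exp (2 * k * Y ω) := by positivity
      linarith
  have hind : Integrable (S.indicator (1 : Ω → ℝ)) μ :=
    (integrable_const (1 : ℝ)).indicator hSm
  have hsum : Integrable
      (fun ω ↦ Real.exp (k ^ 2 / 4) + η * Real.exp (2 * k * Y ω)) μ :=
    (integrable_const _).add (h2.const_mul η)
  have hint := integral_mono h1 (hsum.add (hind.const_mul (4 * η)⁻¹)) hpt
  rw [Pi.add_def, integral_add hsum (hind.const_mul (4 * η)⁻¹),
    integral_add (integrable_const _) (h2.const_mul η), integral_const, integral_const_mul,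
    integral_const_mul, integral_indicator_one hSm, hp, smul_eq_mul] at hint
  set E := Real.exp (k ^ 2 / 2) with hE
  have e1 : Real.exp (k ^ 2 / 4) ≤ E / 2 := by
    have : E = Real.exp (k ^ 2 / 4) * Real.exp (k ^ 2 / 4) := by
      rw [hE, ← Real.exp_add]; congr 1; ring
    have : 2 ≤ Real.exp (k ^ 2 / 4) := by
      have := Real.add_one_le_exp (k ^ 2 / 4)
      nlinarith
    nlinarith [Real.exp_pos (k ^ 2 / 4)]
  have e2 : η * (5 / 4 * p * Real.exp ((2 * k) ^ 2 / 2)) = p * E / 8 := by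
    have : Real.exp (-(3 * k ^ 2 / 2)) * Real.exp ((2 * k) ^ 2 / 2) = E := by
      rw [hE, ← Real.exp_add]; congr 1; ring
    rw [hη, ← this]; ring
  have e3 : η * E = Real.exp (-k ^ 2) / 10 := by
    rw [hη, hE, div_mul_eq_mul_div, ← Real.exp_add]; congr 2; ring
  have e4 : p * E / 8 ≤ (4 * η)⁻¹ * μ.real S := by
    have := mul_le_mul_of_nonneg_left hup hη0.le
    have := mul_le_mul_of_nonneg_left e1 hp0
    linarith
  have e5 : 4 * η * (p * E / 8) ≤ μ.real S := by
    have := mul_le_mul_of_nonneg_left e4 (by positivity : 0 ≤ 4 * η)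
    rwa [mul_inv_cancel_left₀ (by positivity)] at this
  calc _ = 4 * η * (p * E / 8) := by
        rw [show 4 * η * (p * E / 8) = p / 2 * (η * E) by ring, e3]; ring
    _ ≤ _ := e5

end LaplaceTransform

/-- If the direction of `X` is nearly orthogonal to `v` and has a large component along `x`, then
`X` has a large component along the normalization of `v + ‖x‖⁻¹ • x`. -/
lemma le_inner_normalize_add_of_le_inner {E : Type*} [NormedAddCommGroup E]
    [InnerProductSpace ℝ E] {X v x : E} {M s k : ℝ} (hM : 0 < M) (hs : 0 < s) (hk : 264 ≤ k)
    (hv : ‖v‖ ≤ 2) (hx : x ≠ 0) (hxs : ‖x‖ ≤ 3 * s) (hX : M ≤ ‖X‖)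
    (hXv : -(11 / s) ≤ ⟪‖X‖⁻¹ • X, v⟫) (hXx : k / 4 ≤ ⟪‖X‖⁻¹ • X, x⟫) :
    M / s * (k / 72) ≤ ⟪X, ‖v + ‖x‖⁻¹ • x‖⁻¹ • (v + ‖x‖⁻¹ • x)⟫ := by
  set w := v + ‖x‖⁻¹ • x with hw
  have hx0 : 0 < ‖x‖ := norm_pos_iff.2 hx
  have hX0 : 0 < ‖X‖ := hM.trans_le hX
  have hw3 : ‖w‖ ≤ 3 := by
    refine (norm_add_le _ _).trans ?_
    rw [norm_smul, norm_inv, norm_norm, inv_mul_cancel₀ hx0.ne']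
    linarith
  have h1 : k / (12 * s) ≤ ‖x‖⁻¹ * ⟪‖X‖⁻¹ • X, x⟫ := by
    calc k / (12 * s) = (3 * s)⁻¹ * (k / 4) := by field_simp; ring
      _ ≤ ‖x‖⁻¹ * ⟪‖X‖⁻¹ • X, x⟫ := by gcongr
  have h2 : k / (24 * s) ≤ ⟪‖X‖⁻¹ • X, w⟫ := by
    rw [hw, inner_add_right, real_inner_smul_right]
    have : k / (24 * s) ≤ k / (12 * s) - 11 / s := by
      rw [← sub_nonneg]
      have : k / (12 * s) - 11 / s - k / (24 * s) = (k - 264) / (24 * s) := by field_simp; ring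
      rw [this]
      exact div_nonneg (by linarith) (by positivity)
    linarith
  have h3 : ⟪X, w⟫ = ‖X‖ * ⟪‖X‖⁻¹ • X, w⟫ := by
    rw [real_inner_smul_left, mul_inv_cancel_left₀ hX0.ne']
  have hw0 : 0 < ‖w‖ := by
    rw [norm_pos_iff]
    intro h0
    rw [h0, inner_zero_right] at h2
    have : 0 < k / (24 * s) := by positivity
    linarith
  rw [real_inner_smul_right, h3]
  calc M / s * (k / 72) = 3⁻¹ * (M * (k / (24 * s))) := by field_simp; ring
    _ ≤ _ := by gcongr

lemma measure_abs_inner_gt_le {Ω : Type*} [MeasurableSpace Ω] {P : Measure Ω}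
    [IsProbabilityMeasure P] {n : ℕ} (hn : 1 ≤ n) {U : Ω → EuclideanSpace ℝ (Fin n)}
    (hU : Measurable U) (hU1 : ∀ ω, ‖U ω‖ ≤ 1)
    (hcov : ∀ θ : EuclideanSpace ℝ (Fin n), ‖θ‖ = 1 → ∫ ω, ⟪U ω, θ⟫ ^ 2 ∂P ≤ 5 / n)
    {v : EuclideanSpace ℝ (Fin n)} (hv : ‖v‖ ≤ 2) :
    P.real {ω | 11 / Real.sqrt n < |⟪U ω, v⟫|} ≤ 1 / 6 := by
  have hn0 : (0 : ℝ) < n := by exact_mod_cast hn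
  have hcov2 : ∫ ω, ⟪U ω, v⟫ ^ 2 ∂P ≤ 20 / n := by
    rcases eq_or_ne v 0 with rfl | hv0
    · simp only [inner_zero_right, ne_eq, OfNat.ofNat_ne_zero, not_false_eq_true, zero_pow,
        integral_zero]
      positivity
    · have hvn : 0 < ‖v‖ := norm_pos_iff.2 hv0
      have h1 := hcov (‖v‖⁻¹ • v) (by rw [norm_smul, norm_inv, norm_norm, inv_mul_cancel₀ hvn.ne'])
      have h2 : ∀ ω, ⟪U ω, v⟫ ^ 2 = ‖v‖ ^ 2 * ⟪U ω, ‖v‖⁻¹ • v⟫ ^ 2 := fun ω ↦ by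
        rw [real_inner_smul_right]; field_simp
      simp_rw [h2]
      rw [integral_const_mul]
      calc _ ≤ 2 ^ 2 * (5 / (n : ℝ)) := by gcongr
        _ = _ := by ring
  have hint : Integrable (fun ω ↦ ⟪U ω, v⟫ ^ 2) P := by
    refine Integrable.of_bound (by fun_prop) (2 ^ 2)
      (Filter.Eventually.of_forall fun ω ↦ ?_)
    rw [Real.norm_eq_abs, abs_pow]
    gcongr
    exact (abs_real_inner_le_norm _ _).trans (by nlinarith [hU1 ω, norm_nonneg v])
  have hmarkov := mul_meas_ge_le_integral_of_nonneg
    (Filter.Eventually.of_forall fun ω ↦ sq_nonneg ⟪U ω, v⟫) hint (121 / n)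
  have hsub : P.real {ω | 11 / Real.sqrt n < |⟪U ω, v⟫|} ≤
      P.real {ω | 121 / (n : ℝ) ≤ ⟪U ω, v⟫ ^ 2} := by
    refine measureReal_mono fun ω hω ↦ ?_
    have h1 : (11 / Real.sqrt n) ^ 2 ≤ |⟪U ω, v⟫| ^ 2 := by
      gcongr
      exact le_of_lt hω
    rw [div_pow, Real.sq_sqrt hn0.le, sq_abs] at h1
    norm_num at h1
    exact h1
  have h3 : 121 / (n : ℝ) * P.real {ω | 121 / (n : ℝ) ≤ ⟪U ω, v⟫ ^ 2} ≤ 20 / n :=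
    hmarkov.trans hcov2
  have h4 : P.real {ω | 121 / (n : ℝ) ≤ ⟪U ω, v⟫ ^ 2} ≤ 20 / 121 := by
    rw [div_mul_eq_mul_div, div_le_div_iff_of_pos_right hn0] at h3
    linarith
  linarith

/-- The deviation `|L(a) - p e^{a²/2}|` at `x` is less than a quarter of `p e^{a²/2}`, where `L(a)`
is the Laplace transform of `a • W` and `p` is the total mass of the measure. -/
def IsLaplaceConcentratedAt {Ω : Type*} [MeasurableSpace Ω] {n : ℕ} (μ : Measure Ω)
    (W : Ω → EuclideanSpace ℝ (Fin n)) (a : ℝ) (x : EuclideanSpace ℝ (Fin n)) : Prop :=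
  |laplaceTransform μ (fun ω ↦ a • W ω) x - μ.real Set.univ * Real.exp (a ^ 2 / 2)| <
    μ.real Set.univ * Real.exp (a ^ 2 / 2) / 4

lemma exp_neg_sq_le_measureReal_inner {Ω : Type*} [MeasurableSpace Ω] {μ : Measure Ω}
    [IsFiniteMeasure μ] {n : ℕ} {W : Ω → EuclideanSpace ℝ (Fin n)} (hW : Measurable W)
    (hW1 : ∀ᵐ ω ∂μ, ‖W ω‖ = 1) (hμ : 1 / 6 ≤ μ.real Set.univ) {σ k : ℝ} (hσ : σ ^ 2 = 1)
    (hk : 2 ≤ k) {x : EuclideanSpace ℝ (Fin n)} (h1 : IsLaplaceConcentratedAt μ W (σ * k) x)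
    (h2 : IsLaplaceConcentratedAt μ W (σ * (2 * k)) x) :
    Real.exp (-k ^ 2) / 120 ≤ μ.real {ω | k / 4 ≤ σ * ⟪W ω, x⟫} := by
  have hL : ∀ a : ℝ, ∀ ω, Real.exp ⟪(σ * a) • W ω, x⟫ = Real.exp (a * (σ * ⟪W ω, x⟫)) := by
    intro a ω
    rw [real_inner_smul_left]
    ring_nf
  have hint : ∀ a : ℝ, Integrable (fun ω ↦ Real.exp (a * (σ * ⟪W ω, x⟫))) μ := by
    intro a
    simp_rw [← hL]
    refine integrable_exp_inner (V := fun ω ↦ (σ * a) • W ω) (R := |σ * a|) (by fun_prop) ?_ x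
    filter_upwards [hW1] with ω hω
    simp [norm_smul, hω]
  unfold IsLaplaceConcentratedAt laplaceTransform at h1 h2
  simp_rw [hL, mul_pow σ, hσ, one_mul] at h1 h2
  rw [abs_lt] at h1 h2
  refine le_trans ?_ (exp_neg_sq_le_measureReal_tail (Y := fun ω ↦ σ * ⟪W ω, x⟫) (by fun_prop) hk
    (hint _) (hint _) rfl (by linarith) (by linarith))
  have := mul_le_mul_of_nonneg_right hμ (Real.exp_pos (-k ^ 2)).le
  linarith

lemma gaussianMeasure_not_concentrated_le {Ω : Type*} [MeasurableSpace Ω] {μ : Measure Ω}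
    [IsFiniteMeasure μ] {n : ℕ} {W : Ω → EuclideanSpace ℝ (Fin n)} (hn : 1 ≤ n)
    (hW : Measurable W) (hW1 : ∀ᵐ ω ∂μ, ‖W ω‖ = 1) (hμ : μ.real Set.univ ≤ 1)
    (hμ' : 1 / 6 ≤ μ.real Set.univ)
    (hcov : ∀ θ : EuclideanSpace ℝ (Fin n), ‖θ‖ = 1 → ∫ ω, ⟪W ω, θ⟫ ^ 2 ∂μ ≤ 5 / n) {K : ℕ}
    (hK : 16 * (K : ℝ) ^ 2 ≤ Real.log n) :
    gaussianMeasure n {x | ‖x‖ ≤ 3 * Real.sqrt n ∧ ∀ k ∈ Finset.range (K + 1),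
        IsLaplaceConcentratedAt μ W k x ∧ IsLaplaceConcentratedAt μ W (-k) x}ᶜ ≤
      ENNReal.ofReal (6913 / (n : ℝ) ^ (1 / 4 : ℝ)) := by
  have hn0 : (0 : ℝ) < n := by exact_mod_cast hn
  have hdev := gaussianMeasure_laplaceTransform_deviation_le hn hW hW1 hμ hμ' hcov
  set D : ℝ → Set (EuclideanSpace ℝ (Fin n)) := fun a ↦
    {x | μ.real Set.univ * Real.exp (a ^ 2 / 2) / 4 ≤
      |laplaceTransform μ (fun ω ↦ a • W ω) x - μ.real Set.univ * Real.exp (a ^ 2 / 2)|} with hD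
  have hsub : {x | ‖x‖ ≤ 3 * Real.sqrt n ∧ ∀ k ∈ Finset.range (K + 1),
        IsLaplaceConcentratedAt μ W k x ∧ IsLaplaceConcentratedAt μ W (-k) x}ᶜ ⊆
      {x | 3 * Real.sqrt n < ‖x‖} ∪ ⋃ k ∈ Finset.range (K + 1), (D k ∪ D (-k)) := by
    intro x hx
    by_contra hcon
    simp only [Set.mem_union, Set.mem_iUnion, not_or, not_exists] at hcon
    exact hx ⟨not_lt.1 hcon.1, fun k hk ↦
      ⟨not_le.1 (hcon.2 k hk).1, not_le.1 (hcon.2 k hk).2⟩⟩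
  have hs : Real.sqrt n = (n : ℝ) ^ (1 / 4 : ℝ) * (n : ℝ) ^ (1 / 4 : ℝ) := by
    rw [← Real.rpow_add hn0, Real.sqrt_eq_rpow]; norm_num
  have hq : 0 < (n : ℝ) ^ (1 / 4 : ℝ) := by positivity
  have hqn : (n : ℝ) ^ (1 / 4 : ℝ) ≤ n := by
    conv_rhs => rw [← Real.rpow_one (n : ℝ)]
    exact Real.rpow_le_rpow_of_exponent_le (by exact_mod_cast hn) (by norm_num)
  have hexpK : (K + 1) * Real.exp (2 * (K : ℝ) ^ 2) ≤ 2 * (n : ℝ) ^ (1 / 4 : ℝ) := by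
    have h1 : (K : ℝ) + 1 ≤ 2 * Real.exp ((K : ℝ) ^ 2) := by
      nlinarith [Real.add_one_le_exp ((K : ℝ) ^ 2), sq_nonneg ((K : ℝ) - 1)]
    calc (K + 1) * Real.exp (2 * (K : ℝ) ^ 2)
        ≤ 2 * Real.exp ((K : ℝ) ^ 2) * Real.exp (2 * (K : ℝ) ^ 2) := by gcongr
      _ = 2 * Real.exp (3 * (K : ℝ) ^ 2) := by
          rw [mul_assoc, ← Real.exp_add]; ring_nf
      _ ≤ 2 * Real.exp (Real.log n * (1 / 4)) := by
          refine mul_le_mul_of_nonneg_left (Real.exp_le_exp.2 ?_) zero_le_two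
          nlinarith [sq_nonneg (K : ℝ)]
      _ = _ := by rw [Real.rpow_def_of_pos hn0]
  have hexpn : Real.exp (-n) ≤ 1 / (n : ℝ) ^ (1 / 4 : ℝ) := by
    rw [Real.exp_neg, ← one_div]
    gcongr
    linarith [Real.add_one_le_exp (n : ℝ)]
  calc _ ≤ gaussianMeasure n {x | 3 * Real.sqrt n < ‖x‖} +
        ∑ k ∈ Finset.range (K + 1), (gaussianMeasure n (D k) + gaussianMeasure n (D (-k))) := by
        refine (measure_mono hsub).trans ((measure_union_le _ _).trans ?_)
        gcongr
        refine (measure_biUnion_finset_le _ _).trans ?_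
        gcongr
        exact measure_union_le _ _
    _ ≤ ENNReal.ofReal (Real.exp (-n)) + ∑ k ∈ Finset.range (K + 1),
        ENNReal.ofReal (3456 * Real.exp (2 * (K : ℝ) ^ 2) / Real.sqrt n) := by
        refine add_le_add (gaussianMeasure_norm_gt_le n) (Finset.sum_le_sum fun k hk ↦ ?_)
        have hkK : (k : ℝ) ≤ K := by
          exact_mod_cast Nat.lt_succ_iff.1 (Finset.mem_range.1 hk)
        refine (add_le_add (hdev k) (hdev (-k))).trans ?_
        rw [neg_sq, ← ENNReal.ofReal_add (by positivity) (by positivity)]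
        refine ENNReal.ofReal_le_ofReal ?_
        calc _ = 3456 * Real.exp (2 * (k : ℝ) ^ 2) / Real.sqrt n := by ring
          _ ≤ _ := by gcongr
    _ = ENNReal.ofReal (Real.exp (-n) +
          3456 * ((K + 1) * Real.exp (2 * (K : ℝ) ^ 2)) / Real.sqrt n) := by
        rw [Finset.sum_const, Finset.card_range, ← ENNReal.ofReal_nsmul,
          ← ENNReal.ofReal_add (by positivity) (by positivity), nsmul_eq_mul]
        congr 1
        push_cast
        ring
    _ ≤ _ := by
        refine ENNReal.ofReal_le_ofReal ?_
        calc _ ≤ 1 / (n : ℝ) ^ (1 / 4 : ℝ) +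
              3456 * (2 * (n : ℝ) ^ (1 / 4 : ℝ)) / Real.sqrt n := by gcongr
          _ = _ := by rw [hs]; field_simp; norm_num

lemma tail_bounds_of_concentrated {Ω : Type*} [MeasurableSpace Ω] {P : Measure Ω}
    [IsProbabilityMeasure P] {n : ℕ} {X : Ω → EuclideanSpace ℝ (Fin n)} (hX : Measurable X)
    {A : Set Ω} (hA : MeasurableSet A) (hPA : 1 / 6 ≤ P.real A) {M s k σ : ℝ} (hM : 0 < M)
    (hs : 0 < s) {v x : EuclideanSpace ℝ (Fin n)} (hAX : ∀ ω ∈ A, M ≤ ‖X ω‖)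
    (hAv : ∀ ω ∈ A, |⟪‖X ω‖⁻¹ • X ω, v⟫| ≤ 11 / s) (hv : ‖v‖ ≤ 2) (hk : 264 ≤ k)
    (hσ : σ = 1 ∨ σ = -1) (hx : x ≠ 0) (hxs : ‖x‖ ≤ 3 * s)
    (h1 : IsLaplaceConcentratedAt (P.restrict A) (fun ω ↦ ‖X ω‖⁻¹ • X ω) (σ * k) x)
    (h2 : IsLaplaceConcentratedAt (P.restrict A) (fun ω ↦ ‖X ω‖⁻¹ • X ω) (σ * (2 * k)) x) :
    Real.exp (-k ^ 2) / 120 ≤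
      P.real {ω | M / s * (k / 72) ≤ σ * ⟪X ω, ‖v + ‖x‖⁻¹ • x‖⁻¹ • (v + ‖x‖⁻¹ • x)⟫} := by
  have hW : Measurable fun ω ↦ ‖X ω‖⁻¹ • X ω := by fun_prop
  have hW1 : ∀ᵐ ω ∂P.restrict A, ‖‖X ω‖⁻¹ • X ω‖ = 1 := by
    filter_upwards [ae_restrict_mem hA] with ω hω
    rw [norm_smul, norm_inv, norm_norm, inv_mul_cancel₀ (hM.trans_le (hAX ω hω)).ne']
  have hσ2 : σ ^ 2 = 1 := by rcases hσ with rfl | rfl <;> norm_num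
  refine (exp_neg_sq_le_measureReal_inner hW hW1 (by simpa using hPA) hσ2 (by linarith)
    h1 h2).trans ?_
  rw [measureReal_restrict_apply' hA]
  refine measureReal_mono fun ω hω ↦ ?_
  obtain ⟨hωx, hωA⟩ := hω
  have hωv := abs_le.1 (hAv ω hωA)
  rcases hσ with rfl | rfl
  · simp only [Set.mem_ofPred_eq, one_mul] at hωx ⊢
    exact le_inner_normalize_add_of_le_inner hM hs hk hv hx hxs (hAX ω hωA) hωv.1 hωx
  · simp only [Set.mem_ofPred_eq, neg_one_mul] at hωx ⊢
    rw [← inner_neg_left]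
    refine le_inner_normalize_add_of_le_inner hM hs hk hv hx hxs ?_ ?_ ?_
    · simpa using hAX ω hωA
    · rw [norm_neg, smul_neg, inner_neg_left]
      linarith
    · rwa [norm_neg, smul_neg, inner_neg_left]

lemma one_sixth_le_measureReal {Ω : Type*} [MeasurableSpace Ω] {P : Measure Ω}
    [IsProbabilityMeasure P] {S T : Set Ω} (hS : (1 / 3 : ℝ≥0∞) ≤ P S)
    (hT : P.real Tᶜ ≤ 1 / 6) : 1 / 6 ≤ P.real (S ∩ T) := by
  have h1 : 1 / 3 ≤ P.real S := by
    have := ENNReal.toReal_mono (measure_ne_top P S) hS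
    simpa [measureReal_def] using this
  have h2 : P.real S ≤ P.real (S ∩ T) + P.real Tᶜ := by
    refine (measureReal_mono fun ω hω ↦ ?_).trans (measureReal_union_le _ _)
    by_cases h : ω ∈ T
    · exact Or.inl ⟨hω, h⟩
    · exact Or.inr h
  linarith

lemma exists_nat_scale {t T : ℝ} (ht : 0 ≤ t) (htT : t ≤ 5 * T) (hT : 5000 ≤ T) :
    ∃ k : ℕ, 264 ≤ k ∧ 2 * k ≤ ⌊T / 4⌋₊ ∧ t / 80 ≤ k ∧
      Real.exp (-(2 * 265 ^ 2)) / 120 * Real.exp (-2 * t ^ 2) ≤ Real.exp (-(k : ℝ) ^ 2) / 120 := by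
  refine ⟨⌈t / 80⌉₊ + 264, by omega, Nat.le_floor ?_, ?_, ?_⟩
  · have := Nat.ceil_lt_add_one (show 0 ≤ t / 80 by positivity)
    push_cast
    linarith
  · have := Nat.le_ceil (t / 80)
    push_cast
    linarith
  · have h1 := Nat.ceil_lt_add_one (show 0 ≤ t / 80 by positivity)
    rw [div_mul_eq_mul_div, ← Real.exp_add]
    gcongr
    have h2 : ((⌈t / 80⌉₊ + 264 : ℕ) : ℝ) ≤ t / 80 + 265 := by push_cast; linarith
    have h3 : ((⌈t / 80⌉₊ + 264 : ℕ) : ℝ) ^ 2 ≤ (t / 80 + 265) ^ 2 := by gcongr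
    nlinarith [sq_nonneg (t / 80 - 265), sq_nonneg t]

/-- **Corollary 3.6 (central limit regime).** There is a fixed set `F ⊆ S^{n-1}` with
`σ_{n-1}(F) ≥ 1 - C/n^c` such that for every `θ3 ∈ F`, setting
`θ = (θ1 - θ2 + θ3)/|θ1 - θ2 + θ3|`, for all `0 ≤ t ≤ 5√(log n)`:
`min {P(⟨X, θ⟩ ≥ c1 (M/√n) t), P(⟨X, θ⟩ ≤ -c1 (M/√n) t)} ≥ c2 e^{-C3 t²}`. -/
theorem supergaussian_tail_central_limit_regime :
    ∃ c C c1 c2 C3 : ℝ, 0 < c ∧ 0 < C ∧ 0 < c1 ∧ 0 < c2 ∧ 0 < C3 ∧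
      ∀ (n : ℕ), 1 ≤ n →
      ∀ (θ1 θ2 : EuclideanSpace ℝ (Fin n)), ‖θ1‖ = 1 → ‖θ2‖ = 1 →
      ∀ (Ω : Type) (_ : MeasurableSpace Ω) (P : Measure Ω),
        IsProbabilityMeasure P →
      ∀ X : Ω → EuclideanSpace ℝ (Fin n), Measurable X →
        P {ω | X ω = 0} = 0 →
        (∀ θ : EuclideanSpace ℝ (Fin n), ‖θ‖ = 1 →
          ∫ ω, ⟪‖X ω‖⁻¹ • X ω, θ⟫ ^ 2 ∂P ≤ 5 / n) →
      ∀ (M : ℝ), 0 < M →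
        (1 / 3 : ℝ≥0∞) ≤ P {ω | M ≤ ‖X ω‖} →
        (2 / 3 : ℝ≥0∞) ≤ P {ω | ‖X ω‖ ≤ M} →
        ∃ F : Set (sphere (0 : EuclideanSpace ℝ (Fin n)) 1),
          ENNReal.ofReal (1 - C / (n : ℝ) ^ c) ≤ sphereMeasure n F ∧
          ∀ θ3 ∈ F, ∀ t : ℝ, 0 ≤ t → t ≤ 5 * Real.sqrt (Real.log n) →
            ENNReal.ofReal (c2 * Real.exp (-C3 * t ^ 2)) ≤
              min
                (P {ω | c1 * (M / Real.sqrt n) * t ≤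
                  ⟪X ω, ‖θ1 - θ2 + (θ3 : EuclideanSpace ℝ (Fin n))‖⁻¹ •
                    (θ1 - θ2 + (θ3 : EuclideanSpace ℝ (Fin n)))⟫})
                (P {ω | ⟪X ω, ‖θ1 - θ2 + (θ3 : EuclideanSpace ℝ (Fin n))‖⁻¹ •
                    (θ1 - θ2 + (θ3 : EuclideanSpace ℝ (Fin n)))⟫ ≤
                  -(c1 * (M / Real.sqrt n) * t)}) := by
  refine ⟨1 / 4, 6913 + Real.exp (5000 ^ 2), 1 / 5760, Real.exp (-(2 * 265 ^ 2)) / 120, 2,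
    by norm_num, by positivity, by norm_num, by positivity, by norm_num, ?_⟩
  intro n hn θ1 θ2 hθ1 hθ2 Ω _ P _ X hX _ hcov M hM hMge _
  have hn0 : (0 : ℝ) < n := by exact_mod_cast hn
  have hs : 0 < Real.sqrt n := by positivity
  have hq : 0 < (n : ℝ) ^ (1 / 4 : ℝ) := by positivity
  refine ⟨{θ3 | _}, ?_, fun θ3 h ↦ h⟩
  rcases lt_or_ge (Real.sqrt (Real.log n)) 5000 with hsmall | hT
  · have hlog : Real.log n ≤ 5000 ^ 2 := by
      rw [Real.sqrt_lt' (by norm_num)] at hsmall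
      exact hsmall.le
    have hqe : (n : ℝ) ^ (1 / 4 : ℝ) ≤ Real.exp (5000 ^ 2) := by
      rw [Real.rpow_def_of_pos hn0, Real.exp_le_exp]
      linarith
    have : 1 ≤ (6913 + Real.exp (5000 ^ 2)) / (n : ℝ) ^ (1 / 4 : ℝ) := by
      rw [one_le_div hq]
      linarith
    rw [ENNReal.ofReal_of_nonpos (by linarith)]
    exact zero_le
  set v := θ1 - θ2 with hv
  have hv2 : ‖v‖ ≤ 2 := (norm_sub_le _ _).trans (by rw [hθ1, hθ2]; norm_num)
  set U : Ω → EuclideanSpace ℝ (Fin n) := fun ω ↦ ‖X ω‖⁻¹ • X ω with hU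
  have hUm : Measurable U := by fun_prop
  have hU1 : ∀ ω, ‖U ω‖ ≤ 1 := fun ω ↦ by
    rw [hU, norm_smul, norm_inv, norm_norm]
    exact inv_mul_le_one
  set A := {ω | M ≤ ‖X ω‖} ∩ {ω | |⟪U ω, v⟫| ≤ 11 / Real.sqrt n} with hA
  have hAm : MeasurableSet A :=
    (measurableSet_le measurable_const (by fun_prop)).inter
      (measurableSet_le (by fun_prop) measurable_const)
  have hPA : 1 / 6 ≤ P.real A := by
    refine one_sixth_le_measureReal hMge ((measureReal_mono fun ω hω ↦ ?_).trans
      (measure_abs_inner_gt_le hn hUm hU1 hcov hv2))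
    rwa [Set.mem_compl_iff, Set.mem_ofPred_eq, not_le] at hω
  have hcovA : ∀ θ : EuclideanSpace ℝ (Fin n), ‖θ‖ = 1 →
      ∫ ω, ⟪U ω, θ⟫ ^ 2 ∂P.restrict A ≤ 5 / n := by
    intro θ hθ
    refine (setIntegral_le_integral ?_ (Filter.Eventually.of_forall fun ω ↦ sq_nonneg _)).trans
      (hcov θ hθ)
    refine Integrable.of_bound (by fun_prop) 1 (Filter.Eventually.of_forall fun ω ↦ ?_)
    rw [Real.norm_eq_abs, abs_pow]
    refine pow_le_one₀ (abs_nonneg _) ((abs_real_inner_le_norm _ _).trans ?_)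
    rw [hθ, mul_one]
    exact hU1 ω
  have hUA : ∀ᵐ ω ∂P.restrict A, ‖U ω‖ = 1 := by
    filter_upwards [ae_restrict_mem hAm] with ω hω
    rw [hU, norm_smul, norm_inv, norm_norm, inv_mul_cancel₀ (hM.trans_le hω.1).ne']
  set K := ⌊Real.sqrt (Real.log n) / 4⌋₊ with hK
  have hK2 : 16 * (K : ℝ) ^ 2 ≤ Real.log n := by
    have h1 : (K : ℝ) ≤ Real.sqrt (Real.log n) / 4 := Nat.floor_le (by positivity)
    have h2 := Real.sq_sqrt (Real.log_natCast_nonneg n)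
    have h3 : (K : ℝ) ^ 2 ≤ (Real.sqrt (Real.log n) / 4) ^ 2 := by gcongr
    linarith
  have hbad := gaussianMeasure_not_concentrated_le hn hUm hUA
    (by simp) (by simpa using hPA) hcovA hK2
  set S := {x | ‖x‖ ≤ 3 * Real.sqrt n ∧ ∀ k ∈ Finset.range (K + 1),
    IsLaplaceConcentratedAt (P.restrict A) U k x ∧
      IsLaplaceConcentratedAt (P.restrict A) U (-k) x} with hS
  calc ENNReal.ofReal (1 - (6913 + Real.exp (5000 ^ 2)) / (n : ℝ) ^ (1 / 4 : ℝ))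
      ≤ ENNReal.ofReal (1 - 6913 / (n : ℝ) ^ (1 / 4 : ℝ)) := by
        gcongr
        linarith [Real.exp_pos (5000 ^ 2)]
    _ ≤ 1 - gaussianMeasure n Sᶜ := by
        rw [ENNReal.ofReal_sub _ (by positivity), ENNReal.ofReal_one]
        gcongr
    _ ≤ gaussianMeasure n S := by
        rw [tsub_le_iff_right, ← measure_univ (μ := gaussianMeasure n), ← Set.union_compl_self S]
        exact measure_union_le _ _
    _ ≤ _ := by
        refine gaussianMeasure_le_sphereMeasure n hn fun x hxS hx u hu t ht htT ↦ ?_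
        obtain ⟨k, hk264, hkK, htk, hexp⟩ := exists_nat_scale ht htT hT
        have hk264' : (264 : ℝ) ≤ k := by exact_mod_cast hk264
        have hc1 := hxS.2 k (Finset.mem_range.2 (by omega))
        have hc2 := hxS.2 (2 * k) (Finset.mem_range.2 (by omega))
        push_cast at hc2
        have hthr : 1 / 5760 * (M / Real.sqrt n) * t ≤ M / Real.sqrt n * (k / 72) := by
          rw [mul_comm (1 / 5760 : ℝ), mul_assoc]
          gcongr
          linarith
        have htail : ∀ σ : ℝ, σ = 1 ∨ σ = -1 → _ := fun σ hσ ↦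
          tail_bounds_of_concentrated hX hAm hPA (k := k) (σ := σ) hM hs (fun ω hω ↦ hω.1)
            (fun ω hω ↦ hω.2) hv2 hk264' hσ hx hxS.1
            (by rcases hσ with rfl | rfl <;> simp [hc1, hU.symm])
            (by rcases hσ with rfl | rfl <;> simp [hc2, hU.symm])
        rw [hu]
        refine le_min ?_ ?_ <;> refine ENNReal.ofReal_le_of_le_toReal (hexp.trans ?_)
        · refine (htail 1 (Or.inl rfl)).trans (measureReal_mono fun ω hω ↦ ?_)
          rw [Set.mem_ofPred_eq, one_mul] at hω
          exact hthr.trans hω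
        · refine (htail (-1) (Or.inr rfl)).trans (measureReal_mono fun ω hω ↦ ?_)
          rw [Set.mem_ofPred_eq, neg_one_mul] at hω
          rw [Set.mem_ofPred_eq]
          linarith
end
end

section
/- There exist universal constants c1, c2, C3, c, C > 0 such that the following holds. Let N ≥ n ≥ 1 and let x_1,…,x_N ∈ S^{n-1} satisfy ⟨x_i, x_j⟩ ≤ 49/50 for all i ≠ j. Then there exists a subset F ⊆ S^{n-1} with σ_{n-1}(F) ≥ 1 − C/n^c such that for every θ ∈ F and every t ∈ [√(log n), √(log N)], the proportion #{1 ≤ i ≤ N : ⟨x_i, θ⟩ ≥ c1·t/√n}/N is at least c2·e^{−C3·t²}. -/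
open MeasureTheory Metric
open scoped ENNReal RealInnerProductSpace

noncomputable section

section

open ProbabilityTheory Module

section Gaussian
variable {E : Type*} [NormedAddCommGroup E] [InnerProductSpace ℝ E] [FiniteDimensional ℝ E]
  [MeasurableSpace E] [BorelSpace E]

lemma integrable_exp_neg_half_sq_norm :
    Integrable (fun x : E ↦ Real.exp (-(1 / 2) * ‖x‖ ^ 2)) := by
  have h := (GaussianFourier.integrable_cexp_neg_mul_sq_norm_add (V := E) (b := (1 / 2 : ℂ))
    (by norm_num) 0 0).norm
  refine h.congr (ae_of_all _ fun x ↦ ?_)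
  simp [Complex.norm_exp, ← Complex.ofReal_pow]

/-- The standard Gaussian measure has density proportional to `exp (-‖x‖² / 2)`. -/
lemma exists_stdGaussian_eq_withDensity :
    ∃ c : ℝ, 0 < c ∧ stdGaussian E =
      volume.withDensity (fun x : E ↦ ENNReal.ofReal (c * Real.exp (-(1 / 2) * ‖x‖ ^ 2))) := by
  set Z : ℝ := (Real.pi / (1 / 2)) ^ (finrank ℝ E / 2 : ℝ) with hZ
  have hZ0 : 0 < Z := by positivity
  have hint : Integrable (fun x : E ↦ Z⁻¹ * Real.exp (-(1 / 2) * ‖x‖ ^ 2)) :=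
    integrable_exp_neg_half_sq_norm.const_mul _
  have hnn (x : E) : 0 ≤ Z⁻¹ * Real.exp (-(1 / 2) * ‖x‖ ^ 2) := by positivity
  refine ⟨Z⁻¹, by positivity, ?_⟩
  have hfin : IsFiniteMeasure (volume.withDensity
      (fun x : E ↦ ENNReal.ofReal (Z⁻¹ * Real.exp (-(1 / 2) * ‖x‖ ^ 2)))) :=
    isFiniteMeasure_withDensity_ofReal hint.2
  apply Measure.ext_of_charFun
  ext t
  rw [charFun_stdGaussian, charFun_apply, integral_withDensity_eq_integral_toReal_smul (by fun_prop)
    (ae_of_all _ fun _ ↦ ENNReal.ofReal_lt_top)]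
  have h2 := GaussianFourier.integral_cexp_neg_mul_sq_norm_add (V := E) (b := (1 / 2 : ℂ))
    (by norm_num) Complex.I t
  have h3 (x : E) : (ENNReal.ofReal (Z⁻¹ * Real.exp (-(1 / 2) * ‖x‖ ^ 2))).toReal •
      Complex.exp (⟪x, t⟫ * Complex.I) = (Z⁻¹ : ℂ) *
        Complex.exp (-(1 / 2) * ‖x‖ ^ 2 + Complex.I * ⟪t, x⟫) := by
    rw [ENNReal.toReal_ofReal (hnn x), Complex.exp_add, Complex.real_smul, real_inner_comm]
    push_cast
    ring_nf
  simp_rw [h3]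
  rw [integral_const_mul, h2, ← mul_assoc]
  have h4 : (Z : ℂ) = (Real.pi / (1 / 2)) ^ (finrank ℝ E / 2 : ℂ) := by
    rw [hZ, Complex.ofReal_cpow (by positivity)]
    push_cast
    rfl
  rw [← h4, inv_mul_cancel₀ (by exact_mod_cast hZ0.ne'), one_mul]
  congr 1
  simp
  ring

lemma integral_inner_mul_stdGaussian {h : E → ℝ} (hd : Differentiable ℝ h) (v : E) {C : ℝ}
    (hC : ∀ x, |h x| ≤ C) (hC' : ∀ x, |fderiv ℝ h x v| ≤ C) :
    ∫ x, ⟪v, x⟫ * h x ∂(stdGaussian E) = ∫ x, fderiv ℝ h x v ∂(stdGaussian E) := by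
  have hlin : Integrable (fun x : E ↦ ⟪v, x⟫) (stdGaussian E) :=
    (innerSL ℝ v).integrable_comp IsGaussian.integrable_id
  have hlinh : Integrable (fun x : E ↦ h x * ⟪v, x⟫) (stdGaussian E) :=
    hlin.bdd_mul hd.continuous.aestronglyMeasurable (ae_of_all _ hC)
  have hmeas : Measurable (fun x ↦ fderiv ℝ h x v) := measurable_fderiv_apply_const ℝ h v
  have hder : Integrable (fun x ↦ fderiv ℝ h x v) (stdGaussian E) :=
    Integrable.of_bound hmeas.aestronglyMeasurable C (ae_of_all _ hC')
  have hh : Integrable h (stdGaussian E) :=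
    Integrable.of_bound hd.continuous.aestronglyMeasurable C (ae_of_all _ hC)
  obtain ⟨c, hc, hdens⟩ := exists_stdGaussian_eq_withDensity (E := E)
  set g : E → ℝ := fun x ↦ c * Real.exp (-(1 / 2) * ‖x‖ ^ 2) with hg
  have hg0 (x : E) : 0 ≤ g x := by positivity
  have hgm : Measurable (fun x ↦ ENNReal.ofReal (g x)) := by fun_prop
  have key (f : E → ℝ) (hf : Integrable f (stdGaussian E)) :
      Integrable (fun x ↦ g x * f x) ∧
        ∫ x, f x ∂(stdGaussian E) = ∫ x, g x * f x := by
    rw [hdens] at hf ⊢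
    rw [integrable_withDensity_iff_integrable_smul' hgm
      (ae_of_all _ fun _ ↦ ENNReal.ofReal_lt_top)] at hf
    rw [integral_withDensity_eq_integral_toReal_smul hgm
      (ae_of_all _ fun _ ↦ ENNReal.ofReal_lt_top)]
    simp_rw [ENNReal.toReal_ofReal (hg0 _), smul_eq_mul] at hf ⊢
    exact ⟨hf, trivial⟩
  have hgd (x : E) : HasFDerivAt g (-(g x) • innerSL ℝ x) x := by
    have h1 :=
      (((hasStrictFDerivAt_norm_sq x).hasFDerivAt.const_mul (-(1 / 2) : ℝ)).exp).const_mul c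
    refine h1.congr_fderiv ?_
    ext y
    simp [hg]
    ring
  have hgf (x : E) : fderiv ℝ g x v = - (g x * ⟪v, x⟫) := by
    rw [(hgd x).fderiv]
    simp [real_inner_comm]
  have ibp := integral_mul_fderiv_eq_neg_fderiv_mul_of_integrable (μ := (volume : Measure E))
    (f := h) (g := g) (v := v)
    ((key _ hder).1.congr (ae_of_all _ fun x ↦ mul_comm _ _))
    ((key _ hlinh).1.neg.congr (ae_of_all _ fun x ↦ by
      simp only [Pi.neg_apply, hgf]; ring))
    ((key _ hh).1.congr (ae_of_all _ fun x ↦ mul_comm _ _))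
    (fun x _ ↦ hd x) (fun x _ ↦ (hgd x).differentiableAt)
  have e1 : ∫ x, h x * fderiv ℝ g x v = - ∫ x, g x * (h x * ⟪v, x⟫) := by
    rw [← integral_neg]
    congr 1 with x
    rw [hgf]; ring
  rw [e1, neg_inj, ← (key _ hlinh).2] at ibp
  rw [(key _ hder).2]
  simp_rw [mul_comm ⟪v, _⟫]
  rw [ibp]
  simp_rw [mul_comm]

end Gaussian

section Slepian

lemma abs_prod_comp_le_one {ι : Type*} {φ : ℝ → ℝ} (h0 : ∀ x, 0 ≤ φ x) (h1 : ∀ x, φ x ≤ 1)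
    (s : Finset ι) (u : ι → ℝ) : |∏ j ∈ s, φ (u j)| ≤ 1 := by
  rw [abs_of_nonneg (Finset.prod_nonneg fun j _ ↦ h0 _)]
  exact Finset.prod_le_one (fun j _ ↦ h0 _) fun j _ ↦ h1 _

variable {E : Type*} [NormedAddCommGroup E] [InnerProductSpace ℝ E] [FiniteDimensional ℝ E]
  [MeasurableSpace E] [BorelSpace E] {ι : Type*} [Fintype ι] [DecidableEq ι]

/-- If `⟪v, ·⟫` is uncorrelated with `⟪w i, ·⟫` and nonnegatively correlated with every other
`⟪w j, ·⟫`, then it is nonnegatively correlated with the partial derivative along `i` of a product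
of nonincreasing functions. -/
lemma integral_inner_mul_deriv_prod_nonneg {φ φ' φ'' : ℝ → ℝ} {C : ℝ}
    (hφ : ∀ x, HasDerivAt φ (φ' x) x) (hφ' : ∀ x, HasDerivAt φ' (φ'' x) x)
    (h0 : ∀ x, 0 ≤ φ x) (h1 : ∀ x, φ x ≤ 1) (hneg : ∀ x, φ' x ≤ 0) (hC : ∀ x, |φ' x| ≤ C)
    (w : ι → E) (i : ι) (v : E) (hi : ⟪w i, v⟫ = 0) (hj : ∀ j, j ≠ i → 0 ≤ ⟪w j, v⟫) :
    0 ≤ ∫ g, ⟪v, g⟫ * (φ' ⟪w i, g⟫ * ∏ j ∈ Finset.univ.erase i, φ ⟪w j, g⟫)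
      ∂(stdGaussian E) := by
  have hC0 : 0 ≤ C := (abs_nonneg _).trans (hC 0)
  set D : E → ℝ := fun g ↦ φ' ⟪w i, g⟫ * ∑ j ∈ Finset.univ.erase i,
    (∏ k ∈ (Finset.univ.erase i).erase j, φ ⟪w k, g⟫) * (φ' ⟪w j, g⟫ * ⟪w j, v⟫) with hD
  have hder (g : E) : HasFDerivAt
      (fun g ↦ φ' ⟪w i, g⟫ * ∏ j ∈ Finset.univ.erase i, φ ⟪w j, g⟫)
      (φ' ⟪w i, g⟫ • (∑ j ∈ Finset.univ.erase i,
        (∏ k ∈ (Finset.univ.erase i).erase j, φ ⟪w k, g⟫) • (φ' ⟪w j, g⟫ • innerSL ℝ (w j))) +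
        (∏ j ∈ Finset.univ.erase i, φ ⟪w j, g⟫) • (φ'' ⟪w i, g⟫ • innerSL ℝ (w i))) g := by
    have hl (j : ι) : HasFDerivAt (fun g : E ↦ ⟪w j, g⟫) (innerSL ℝ (w j)) g :=
      (innerSL ℝ (w j)).hasFDerivAt
    exact ((hφ' _).comp_hasFDerivAt g (hl i)).mul
      (HasFDerivAt.finsetProd fun j _ ↦ (hφ _).comp_hasFDerivAt g (hl j))
  have hfd (g : E) :
      fderiv ℝ (fun g ↦ φ' ⟪w i, g⟫ * ∏ j ∈ Finset.univ.erase i, φ ⟪w j, g⟫) g v = D g := by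
    rw [(hder g).fderiv]
    simp [hD, hi]
  set K : ℝ := C * ∑ j ∈ Finset.univ.erase i, C * |⟪w j, v⟫| with hK
  have hDK (g : E) : |D g| ≤ K := by
    rw [hD, abs_mul]
    refine mul_le_mul (hC _) ((Finset.abs_sum_le_sum_abs _ _).trans
      (Finset.sum_le_sum fun j _ ↦ ?_)) (abs_nonneg _) hC0
    rw [abs_mul, abs_mul]
    refine (mul_le_of_le_one_left (by positivity) (abs_prod_comp_le_one h0 h1 _ _)).trans ?_
    gcongr
    exact hC _
  have hbd (g : E) : |φ' ⟪w i, g⟫ * ∏ j ∈ Finset.univ.erase i, φ ⟪w j, g⟫| ≤ C := by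
    rw [abs_mul]
    exact (mul_le_of_le_one_right (abs_nonneg _) (abs_prod_comp_le_one h0 h1 _ _)).trans (hC _)
  rw [integral_inner_mul_stdGaussian (fun g ↦ (hder g).differentiableAt) v (C := max C K)
    (fun g ↦ (hbd g).trans (le_max_left _ _))
    (fun g ↦ by rw [hfd]; exact (hDK g).trans (le_max_right _ _))]
  refine integral_nonneg fun g ↦ ?_
  rw [Pi.zero_apply, hfd]
  refine mul_nonneg_of_nonpos_of_nonpos (hneg _) (Finset.sum_nonpos fun j hjs ↦ ?_)
  exact mul_nonpos_of_nonneg_of_nonpos (Finset.prod_nonneg fun _ _ ↦ h0 _)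
    (mul_nonpos_of_nonpos_of_nonneg (hneg _) (hj j (Finset.ne_of_mem_erase hjs)))

/-- Slepian's comparison for products of a smooth nonincreasing function. -/
lemma integral_prod_le_of_inner_le {φ φ' φ'' : ℝ → ℝ} {C : ℝ}
    (hφ : ∀ x, HasDerivAt φ (φ' x) x) (hφ' : ∀ x, HasDerivAt φ' (φ'' x) x)
    (h0 : ∀ x, 0 ≤ φ x) (h1 : ∀ x, φ x ≤ 1) (hneg : ∀ x, φ' x ≤ 0) (hC : ∀ x, |φ' x| ≤ C)
    (x y : ι → E) (hxy : ∀ i j, ⟪x i, y j⟫ = 0) (hnorm : ∀ i, ⟪x i, x i⟫ = ⟪y i, y i⟫)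
    (hle : ∀ i j, i ≠ j → ⟪x i, x j⟫ ≤ ⟪y i, y j⟫) :
    ∫ g, ∏ i, φ ⟪x i, g⟫ ∂(stdGaussian E) ≤ ∫ g, ∏ i, φ ⟪y i, g⟫ ∂(stdGaussian E) := by
  have hC0 : 0 ≤ C := (abs_nonneg _).trans (hC 0)
  have hφc : Continuous φ := continuous_iff_continuousAt.2 fun x ↦ (hφ x).continuousAt
  have hφc' : Continuous φ' := continuous_iff_continuousAt.2 fun x ↦ (hφ' x).continuousAt
  set w : ℝ → ι → E := fun a i ↦ Real.cos a • x i + Real.sin a • y i with hw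
  set w' : ℝ → ι → E := fun a i ↦ -Real.sin a • x i + Real.cos a • y i with hw'
  set G : ℝ → E → ℝ := fun a g ↦ ∑ i, ⟪w' a i, g⟫ *
    (φ' ⟪w a i, g⟫ * ∏ j ∈ Finset.univ.erase i, φ ⟪w a j, g⟫) with hG
  have hyx (i j : ι) : ⟪y i, x j⟫ = 0 := by rw [real_inner_comm, hxy]
  have hww (a : ℝ) (i j : ι) :
      ⟪w a j, w' a i⟫ = Real.sin a * Real.cos a * (⟪y j, y i⟫ - ⟪x j, x i⟫) := by
    simp only [hw, hw', inner_add_left, inner_add_right, real_inner_smul_left,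
      real_inner_smul_right, hxy, hyx]
    ring
  have hderiv (a : ℝ) (g : E) : HasDerivAt (fun a ↦ ∏ i, φ ⟪w a i, g⟫) (G a g) a := by
    have hi (i : ι) : HasDerivAt (fun a ↦ ⟪w a i, g⟫) ⟪w' a i, g⟫ a := by
      have := ((Real.hasDerivAt_cos a).smul_const (x i)).add
        ((Real.hasDerivAt_sin a).smul_const (y i))
      have h2 := this.inner ℝ (hasDerivAt_const a g)
      simpa [hw, hw'] using h2
    have := HasDerivAt.fun_finsetProd (u := Finset.univ) (x := a) (f := fun i a ↦ φ ⟪w a i, g⟫)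
      (f' := fun i ↦ φ' ⟪w a i, g⟫ * ⟪w' a i, g⟫)
      fun i _ ↦ (hφ _).comp a (hi i)
    refine this.congr_deriv (Finset.sum_congr rfl fun i _ ↦ ?_)
    rw [smul_eq_mul]
    ring
  have hbound (a : ℝ) (i : ι) (g : E) :
      |⟪w' a i, g⟫ * (φ' ⟪w a i, g⟫ * ∏ j ∈ Finset.univ.erase i, φ ⟪w a j, g⟫)| ≤
        (‖x i‖ + ‖y i‖) * ‖g‖ * C := by
    rw [abs_mul, abs_mul]
    have e1 : ‖w' a i‖ ≤ ‖x i‖ + ‖y i‖ := by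
      refine (norm_add_le _ _).trans ?_
      rw [norm_smul, norm_smul, norm_neg]
      exact add_le_add (mul_le_of_le_one_left (norm_nonneg _) (Real.abs_sin_le_one a))
        (mul_le_of_le_one_left (norm_nonneg _) (Real.abs_cos_le_one a))
    have e2 : |⟪w' a i, g⟫| ≤ (‖x i‖ + ‖y i‖) * ‖g‖ :=
      (abs_real_inner_le_norm _ _).trans (by gcongr)
    have e3 : |φ' ⟪w a i, g⟫| * |∏ j ∈ Finset.univ.erase i, φ ⟪w a j, g⟫| ≤ C :=
      (mul_le_of_le_one_right (abs_nonneg _) (abs_prod_comp_le_one h0 h1 _ _)).trans (hC _)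
    exact mul_le_mul e2 e3 (by positivity) (by positivity)
  have hnormint : Integrable (fun g : E ↦ ‖g‖) (stdGaussian E) :=
    IsGaussian.integrable_id.norm
  have hcont (a : ℝ) (i : ι) : Continuous fun g ↦
      ⟪w' a i, g⟫ * (φ' ⟪w a i, g⟫ * ∏ j ∈ Finset.univ.erase i, φ ⟪w a j, g⟫) := by
    fun_prop
  have hint (a : ℝ) (i : ι) : Integrable (fun g ↦
      ⟪w' a i, g⟫ * (φ' ⟪w a i, g⟫ * ∏ j ∈ Finset.univ.erase i, φ ⟪w a j, g⟫))
      (stdGaussian E) :=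
    ((hnormint.const_mul (‖x i‖ + ‖y i‖)).mul_const C).mono'
      (hcont a i).aestronglyMeasurable (ae_of_all _ (hbound a i))
  have hF (a : ℝ) : HasDerivAt (fun a ↦ ∫ g, ∏ i, φ ⟪w a i, g⟫ ∂(stdGaussian E))
      (∫ g, G a g ∂(stdGaussian E)) a := by
    have hc (a : ℝ) : Continuous fun g ↦ ∏ i, φ ⟪w a i, g⟫ := by fun_prop
    refine (hasDerivAt_integral_of_dominated_loc_of_deriv_le (s := Set.univ)
      (bound := fun g ↦ ∑ i, (‖x i‖ + ‖y i‖) * ‖g‖ * C) Filter.univ_mem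
      (Filter.Eventually.of_forall fun a ↦ (hc a).aestronglyMeasurable)
      (Integrable.of_bound (hc a).aestronglyMeasurable 1
        (ae_of_all _ fun g ↦ abs_prod_comp_le_one h0 h1 _ _))
      (continuous_finsetSum _ fun i _ ↦ hcont a i).aestronglyMeasurable
      (ae_of_all _ fun g a _ ↦ ?_)
      (integrable_finsetSum _ fun i _ ↦ (hnormint.const_mul (‖x i‖ + ‖y i‖)).mul_const C)
      (ae_of_all _ fun g a _ ↦ hderiv a g)).2
    exact (Finset.abs_sum_le_sum_abs _ _).trans (Finset.sum_le_sum fun i _ ↦ hbound a i g)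
  have hpos : 0 ≤ Real.pi / 2 := by positivity
  have hmono : MonotoneOn (fun a ↦ ∫ g, ∏ i, φ ⟪w a i, g⟫ ∂(stdGaussian E))
      (Set.Icc 0 (Real.pi / 2)) := by
    refine monotoneOn_of_deriv_nonneg (convex_Icc _ _)
      (fun a _ ↦ (hF a).continuousAt.continuousWithinAt)
      (fun a _ ↦ (hF a).differentiableAt.differentiableWithinAt) fun a ha ↦ ?_
    rw [interior_Icc] at ha
    rw [(hF a).deriv, integral_finsetSum _ fun i _ ↦ hint a i]
    refine Finset.sum_nonneg fun i _ ↦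
      integral_inner_mul_deriv_prod_nonneg hφ hφ' h0 h1 hneg hC _ _ _ ?_ fun j hj ↦ ?_
    · rw [hww, hnorm, sub_self, mul_zero]
    · rw [hww]
      have hs : 0 ≤ Real.sin a := Real.sin_nonneg_of_nonneg_of_le_pi ha.1.le (by linarith [ha.2])
      have hc : 0 ≤ Real.cos a := Real.cos_nonneg_of_mem_Icc ⟨by linarith [ha.1], ha.2.le⟩
      have := hle j i hj
      exact mul_nonneg (mul_nonneg hs hc) (by linarith)
  have := hmono (Set.left_mem_Icc.2 hpos) (Set.right_mem_Icc.2 hpos) hpos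
  simpa [hw] using this

/-- A bound, with a loss of `1` in the level, for the probability that all coordinates of a Gaussian
vector are small, by that of a more correlated one (a version of Slepian's inequality). -/
lemma stdGaussian_forall_inner_lt_le (x y : ι → E) (hxy : ∀ i j, ⟪x i, y j⟫ = 0)
    (hnorm : ∀ i, ⟪x i, x i⟫ = ⟪y i, y i⟫)
    (hle : ∀ i j, i ≠ j → ⟪x i, x j⟫ ≤ ⟪y i, y j⟫) (u : ℝ) :
    (stdGaussian E).real {g | ∀ i, ⟪x i, g⟫ < u} ≤
      (stdGaussian E).real {g | ∀ i, ⟪y i, g⟫ < u + 1} := by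
  set φ : ℝ → ℝ := fun t ↦ Real.smoothTransition (u + 1 - t) with hφdef
  have hsm : ContDiff ℝ 2 φ :=
    (Real.smoothTransition.contDiff (n := 2)).comp (contDiff_const.sub contDiff_id)
  have hsm' : ContDiff ℝ 1 (deriv φ) := by
    have : ContDiff ℝ (1 + 1) φ := by simpa [one_add_one_eq_two] using hsm
    exact (contDiff_succ_iff_deriv.1 this).2.2
  have hanti : Antitone φ := fun a b hab ↦ Real.smoothTransition.monotone (by linarith)
  have hφ1 (t : ℝ) (ht : t ≤ u) : φ t = 1 := Real.smoothTransition.one_of_one_le (by linarith)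
  have hφ0 (t : ℝ) (ht : u + 1 ≤ t) : φ t = 0 :=
    Real.smoothTransition.zero_of_nonpos (by linarith)
  have hsupp : HasCompactSupport (deriv φ) := by
    refine HasCompactSupport.intro (isCompact_Icc (a := u) (b := u + 1)) fun t ht ↦ ?_
    rcases lt_or_ge t u with h | h
    · have : φ =ᶠ[nhds t] fun _ ↦ 1 := by
        filter_upwards [Iio_mem_nhds h] with s hs using hφ1 s (le_of_lt hs)
      rw [this.deriv_eq, deriv_const]
    · have h' : u + 1 < t := by
        by_contra hcon
        exact ht ⟨h, not_lt.1 hcon⟩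
      have : φ =ᶠ[nhds t] fun _ ↦ 0 := by
        filter_upwards [Ioi_mem_nhds h'] with s hs using hφ0 s (le_of_lt hs)
      rw [this.deriv_eq, deriv_const]
  obtain ⟨C, hC⟩ := hsm'.continuous.bounded_above_of_compact_support hsupp
  have h01 (t : ℝ) : 0 ≤ φ t := Real.smoothTransition.nonneg _
  have h11 (t : ℝ) : φ t ≤ 1 := Real.smoothTransition.le_one _
  have main := integral_prod_le_of_inner_le (φ := φ) (φ' := deriv φ) (φ'' := deriv (deriv φ))
    (C := C) (fun t ↦ (hsm.differentiable (by norm_num) t).hasDerivAt)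
    (fun t ↦ (hsm'.differentiable (by norm_num) t).hasDerivAt)
    h01 h11 (fun t ↦ hanti.deriv_nonpos) hC x y hxy hnorm hle
  have hint (z : ι → E) : Integrable (fun g ↦ ∏ i, φ ⟪z i, g⟫) (stdGaussian E) := by
    have hc : Continuous fun g ↦ ∏ i, φ ⟪z i, g⟫ := by
      have := hsm.continuous
      fun_prop
    exact Integrable.of_bound hc.aestronglyMeasurable 1
      (ae_of_all _ fun g ↦ abs_prod_comp_le_one h01 h11 _ _)
  have hmeas (z : ι → E) (s : ℝ) : MeasurableSet {g : E | ∀ i, ⟪z i, g⟫ < s} := by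
    rw [Set.ofPred_forall]
    exact MeasurableSet.iInter fun i ↦ measurableSet_lt (by fun_prop) measurable_const
  calc (stdGaussian E).real {g | ∀ i, ⟪x i, g⟫ < u}
      = ∫ g, ({g | ∀ i, ⟪x i, g⟫ < u} : Set E).indicator 1 g ∂(stdGaussian E) :=
        (integral_indicator_one (hmeas x u)).symm
    _ ≤ ∫ g, ∏ i, φ ⟪x i, g⟫ ∂(stdGaussian E) := by
        refine integral_mono ((integrable_const (1 : ℝ)).indicator (hmeas x u)) (hint x) fun g ↦ ?_
        refine Set.indicator_le' (g := fun g ↦ ∏ i, φ ⟪x i, g⟫) (fun g hg ↦ ?_)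
          (fun g _ ↦ Finset.prod_nonneg fun i _ ↦ h01 _) g
        rw [Finset.prod_eq_one fun i _ ↦ hφ1 _ (hg i).le, Pi.one_apply]
    _ ≤ ∫ g, ∏ i, φ ⟪y i, g⟫ ∂(stdGaussian E) := main
    _ ≤ ∫ g, ({g | ∀ i, ⟪y i, g⟫ < u + 1} : Set E).indicator 1 g ∂(stdGaussian E) := by
        refine integral_mono (hint y) ((integrable_const (1 : ℝ)).indicator (hmeas y _)) fun g ↦ ?_
        refine Set.le_indicator (f := fun g ↦ ∏ i, φ ⟪y i, g⟫)
          (fun g _ ↦ Finset.prod_le_one (fun i _ ↦ h01 _) fun i _ ↦ h11 _)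
          (fun g hg ↦ ?_) g
        obtain ⟨i, hi⟩ : ∃ i, u + 1 ≤ ⟪y i, g⟫ := by simpa using hg
        exact (Finset.prod_eq_zero (Finset.mem_univ i) (hφ0 _ hi)).le
    _ = _ := integral_indicator_one (hmeas y _)

end Slepian

section GaussianMaximum
variable {E : Type*} [NormedAddCommGroup E] [InnerProductSpace ℝ E] [FiniteDimensional ℝ E]
  [MeasurableSpace E] [BorelSpace E]

lemma stdGaussian_map_of_inner_eq {H : Type*} [NormedAddCommGroup H] [InnerProductSpace ℝ H]
    [FiniteDimensional ℝ H] [MeasurableSpace H] [BorelSpace H] (L : H →L[ℝ] E) (J : E → H)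
    (hLJ : ∀ h t, ⟪L h, t⟫ = ⟪h, J t⟫) (hJ : ∀ t, ‖J t‖ = ‖t‖) :
    (stdGaussian H).map L = stdGaussian E := by
  apply Measure.ext_of_charFun
  ext t
  rw [charFun_apply, integral_map (by fun_prop) (by fun_prop)]
  simp_rw [hLJ]
  rw [← charFun_apply, charFun_stdGaussian, charFun_stdGaussian, hJ]

lemma gaussianReal_real_Iic_neg_le {s : ℝ} (hs : 0 ≤ s) :
    (gaussianReal 0 1).real (Set.Iic (-s)) ≤ Real.exp (-s ^ 2 / 2) := by
  have h := measure_le_le_exp_mul_mgf (μ := gaussianReal 0 1) (X := id) (t := -s) (-s)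
    (by linarith) (integrable_exp_mul_gaussianReal _)
  rw [mgf_id_gaussianReal, ← Real.exp_add] at h
  refine h.trans (Real.exp_le_exp.2 (le_of_eq ?_))
  simp
  ring

lemma le_gaussianReal_real_Ici {w : ℝ} (hw : 0 ≤ w) :
    (√(2 * Real.pi))⁻¹ * Real.exp (-(w + 1) ^ 2 / 2) ≤ (gaussianReal 0 1).real (Set.Ici w) := by
  refine le_trans ?_ (measureReal_mono (Set.Icc_subset_Ici_self (b := w) (a := w + 1)))
  rw [measureReal_def, gaussianReal_apply_eq_integral _ one_ne_zero, ENNReal.toReal_ofReal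
    (setIntegral_nonneg measurableSet_Icc fun _ _ ↦ gaussianPDFReal_nonneg _ _ _)]
  have h := setIntegral_mono_on (μ := (volume : Measure ℝ)) (s := Set.Icc w (w + 1))
    (f := fun _ ↦ (√(2 * Real.pi))⁻¹ * Real.exp (-(w + 1) ^ 2 / 2)) (g := gaussianPDFReal 0 1)
    continuous_const.integrableOn_Icc (integrable_gaussianPDFReal 0 1).integrableOn
    measurableSet_Icc fun x hx ↦ ?_
  · simpa using h
  · rw [gaussianPDFReal_def]
    simp only [NNReal.coe_one, mul_one, sub_zero]
    have h0 : 0 ≤ x := hw.trans hx.1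
    have h1 : x ≤ w + 1 := hx.2
    gcongr

/-- The maximum of independent Gaussians with a common component is rarely small. -/
lemma stdGaussian_forall_common_add_lt_le {M : ℕ} {a b : ℝ} (ha : 0 ≤ a) (hb : 0 < b) (v s : ℝ) :
    (stdGaussian (EuclideanSpace ℝ (Option (Fin M)))).real
      {z | ∀ i, a * z none + b * z (some i) < v} ≤
      (gaussianReal 0 1).real (Set.Iic (-s)) +
        (gaussianReal 0 1).real (Set.Iio ((v + a * s) / b)) ^ M := by
  set ν : Measure (Option (Fin M) → ℝ) := Measure.pi fun _ ↦ gaussianReal 0 1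
  have hms : MeasurableSet {z : EuclideanSpace ℝ (Option (Fin M)) |
      ∀ i, a * z none + b * z (some i) < v} := by
    rw [Set.ofPred_forall]
    exact MeasurableSet.iInter fun i ↦ measurableSet_lt (by fun_prop) measurable_const
  rw [← map_pi_eq_stdGaussian, map_measureReal_apply (by fun_prop) hms]
  have box (t : Option (Fin M) → Set ℝ) :
      ν.real (Set.univ.pi t) = ∏ o, (gaussianReal 0 1).real (t o) := by
    simp [ν, measureReal_def, Measure.pi_pi, ENNReal.toReal_prod]
  have hsub : (WithLp.toLp 2) ⁻¹' {z : EuclideanSpace ℝ (Option (Fin M)) |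
      ∀ i, a * z none + b * z (some i) < v} ⊆
      (Set.univ.pi fun o : Option (Fin M) ↦ o.elim (Set.Iic (-s)) fun _ ↦ Set.univ) ∪
        (Set.univ.pi fun o : Option (Fin M) ↦
          o.elim Set.univ fun _ ↦ Set.Iio ((v + a * s) / b)) := by
    intro z hz
    by_cases h : z none ≤ -s
    · left
      rintro (_ | i) -
      · exact h
      · trivial
    · right
      rintro (_ | i) -
      · trivial
      · have h1 : a * z none + b * z (some i) < v := hz i
        have h2 : a * (-s) ≤ a * z none := mul_le_mul_of_nonneg_left (not_le.1 h).le ha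
        change z (some i) < (v + a * s) / b
        rw [lt_div_iff₀ hb]
        linarith
  refine (measureReal_mono hsub).trans ((measureReal_union_le _ _).trans ?_)
  rw [box, box]
  simp [Fintype.prod_option]

/-- Lower tail bound for the maximum of Gaussians with pairwise correlations at most `49 / 50`. -/
lemma stdGaussian_forall_inner_lt_le_tails {M : ℕ} (x : Fin M → E) (hx : ∀ i, ‖x i‖ = 1)
    (hxx : ∀ i j, i ≠ j → ⟪x i, x j⟫ ≤ 49 / 50) (u s : ℝ) :
    (stdGaussian E).real {g | ∀ i, ⟪x i, g⟫ < u} ≤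
      (gaussianReal 0 1).real (Set.Iic (-s)) +
        (gaussianReal 0 1).real (Set.Iio ((u + 1 + 112 / 113 * s) / (15 / 113))) ^ M := by
  set y : Fin M → EuclideanSpace ℝ (Option (Fin M)) := fun i ↦
    (112 / 113 : ℝ) • EuclideanSpace.single none (1 : ℝ) +
      (15 / 113 : ℝ) • EuclideanSpace.single (some i) (1 : ℝ) with hy
  have hyz (i : Fin M) (z : EuclideanSpace ℝ (Option (Fin M))) :
      ⟪y i, z⟫ = 112 / 113 * z none + 15 / 113 * z (some i) := by
    simp [hy, inner_add_left, real_inner_smul_left, EuclideanSpace.inner_single_left]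
  set X : Fin M → WithLp 2 (E × EuclideanSpace ℝ (Option (Fin M))) :=
    fun i ↦ WithLp.toLp 2 (x i, 0)
  set Y : Fin M → WithLp 2 (E × EuclideanSpace ℝ (Option (Fin M))) :=
    fun i ↦ WithLp.toLp 2 (0, y i)
  have hXg (i : Fin M) (g : WithLp 2 (E × EuclideanSpace ℝ (Option (Fin M)))) :
      ⟪X i, g⟫ = ⟪x i, g.fst⟫ := by
    simp [X, WithLp.prod_inner_apply]
  have hYg (i : Fin M) (g : WithLp 2 (E × EuclideanSpace ℝ (Option (Fin M)))) :
      ⟪Y i, g⟫ = ⟪y i, g.snd⟫ := by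
    simp [Y, WithLp.prod_inner_apply]
  have hfst : (stdGaussian (WithLp 2 (E × EuclideanSpace ℝ (Option (Fin M))))).map
      (WithLp.fstL 2 ℝ E (EuclideanSpace ℝ (Option (Fin M)))) = stdGaussian E :=
    stdGaussian_map_of_inner_eq _ (fun t ↦ WithLp.toLp 2 (t, 0))
      (fun h t ↦ by simp [WithLp.prod_inner_apply]) (fun t ↦ by simp)
  have hsnd : (stdGaussian (WithLp 2 (E × EuclideanSpace ℝ (Option (Fin M))))).map
      (WithLp.sndL 2 ℝ E (EuclideanSpace ℝ (Option (Fin M)))) =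
        stdGaussian (EuclideanSpace ℝ (Option (Fin M))) :=
    stdGaussian_map_of_inner_eq _ (fun t ↦ WithLp.toLp 2 (0, t))
      (fun h t ↦ by simp [WithLp.prod_inner_apply]) (fun t ↦ by simp)
  have key := stdGaussian_forall_inner_lt_le X Y (fun i j ↦ by simp [hXg, Y])
    (fun i ↦ by
      rw [hXg, hYg]
      simp only [X, Y, WithLp.toLp_fst, WithLp.toLp_snd]
      rw [real_inner_self_eq_norm_sq, hx, hyz]
      simp [hy]
      norm_num)
    (fun i j hij ↦ by
      rw [hXg, hYg]
      simp only [X, Y, WithLp.toLp_fst, WithLp.toLp_snd]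
      rw [hyz]
      refine (hxx i j hij).trans ?_
      simp [hy, hij]
      norm_num) u
  have hm1 : MeasurableSet {g : E | ∀ i, ⟪x i, g⟫ < u} := by
    rw [Set.ofPred_forall]
    exact MeasurableSet.iInter fun i ↦ measurableSet_lt (by fun_prop) measurable_const
  have hm2 : MeasurableSet {z : EuclideanSpace ℝ (Option (Fin M)) | ∀ i, ⟪y i, z⟫ < u + 1} := by
    rw [Set.ofPred_forall]
    exact MeasurableSet.iInter fun i ↦ measurableSet_lt (by fun_prop) measurable_const
  simp_rw [hXg, hYg] at key
  have e1 : (stdGaussian E).real {g | ∀ i, ⟪x i, g⟫ < u} =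
      (stdGaussian (WithLp 2 (E × EuclideanSpace ℝ (Option (Fin M))))).real
        {g | ∀ i, ⟪x i, g.fst⟫ < u} := by
    rw [← hfst, map_measureReal_apply (by fun_prop) hm1]
    rfl
  have e2 : (stdGaussian (EuclideanSpace ℝ (Option (Fin M)))).real {z | ∀ i, ⟪y i, z⟫ < u + 1} =
      (stdGaussian (WithLp 2 (E × EuclideanSpace ℝ (Option (Fin M))))).real
        {g | ∀ i, ⟪y i, g.snd⟫ < u + 1} := by
    rw [← hsnd, map_measureReal_apply (by fun_prop) hm2]
    rfl
  rw [e1]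
  refine key.trans ?_
  rw [← e2]
  simp_rw [hyz]
  exact stdGaussian_forall_common_add_lt_le (by norm_num) (by norm_num) _ _

lemma exists_stdGaussian_forall_inner_lt_sqrt_log_le :
    ∃ A : ℝ, 0 < A ∧ ∀ {E : Type} [NormedAddCommGroup E] [InnerProductSpace ℝ E]
      [FiniteDimensional ℝ E] [MeasurableSpace E] [BorelSpace E] {M : ℕ} (_ : 1 ≤ M)
      (x : Fin M → E), (∀ i, ‖x i‖ = 1) → (∀ i j, i ≠ j → ⟪x i, x j⟫ ≤ 49 / 50) →
      (stdGaussian E).real {g | ∀ i, ⟪x i, g⟫ < √(Real.log M) / 32} ≤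
        A * (M : ℝ) ^ (-(1 / 2048) : ℝ) := by
  set κ : ℝ := (√(2 * Real.pi))⁻¹ with hκ
  have hκ0 : 0 < κ := by positivity
  refine ⟨1 + κ⁻¹ * Real.exp 81, by positivity, ?_⟩
  intro E _ _ _ _ _ M hM x hx hxx
  have hM0 : (0 : ℝ) < M := by exact_mod_cast hM
  set L := Real.log M with hL
  have hL0 : 0 ≤ L := Real.log_nonneg (by exact_mod_cast hM)
  have hML : (M : ℝ) = Real.exp L := (Real.exp_log hM0).symm
  set u := √L / 32 with hu
  have hu0 : 0 ≤ u := by positivity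
  have hu2 : u ^ 2 = L / 1024 := by
    rw [hu, div_pow, Real.sq_sqrt hL0]; norm_num
  have hpow : (M : ℝ) ^ (-(1 / 2048) : ℝ) = Real.exp (-(L / 2048)) := by
    rw [Real.rpow_def_of_pos hM0]; congr 1; ring
  set w := (u + 1 + 112 / 113 * u) / (15 / 113) with hw
  have hw0 : 0 ≤ w := by positivity
  have hw9 : w + 1 ≤ 15 * u + 9 := by
    rw [hw, div_add_one (by norm_num), div_le_iff₀ (by norm_num)]
    linarith
  set p := κ * Real.exp (-(w + 1) ^ 2 / 2) with hp
  have hp0 : 0 < p := by positivity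
  have h1 : (gaussianReal 0 1).real (Set.Iic (-u)) ≤ Real.exp (-(L / 2048)) := by
    refine (gaussianReal_real_Iic_neg_le hu0).trans (Real.exp_le_exp.2 ?_)
    rw [hu2]; linarith
  have h2 : (gaussianReal 0 1).real (Set.Iio w) ≤ Real.exp (-p) := by
    rw [← Set.compl_Ici, probReal_compl_eq_one_sub measurableSet_Ici]
    linarith [le_gaussianReal_real_Ici hw0, Real.add_one_le_exp (-p)]
  have h3 : κ * Real.exp (-81) * Real.exp (L / 2048) ≤ p * M := by
    rw [hp, hML, mul_assoc, mul_assoc, ← Real.exp_add, ← Real.exp_add]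
    refine mul_le_mul_of_nonneg_left (Real.exp_le_exp.2 ?_) hκ0.le
    have h5 : (w + 1) ^ 2 ≤ (15 * u + 9) ^ 2 := pow_le_pow_left₀ (by linarith) hw9 2
    nlinarith [sq_nonneg (15 * u - 9)]
  have h4 : (gaussianReal 0 1).real (Set.Iio w) ^ M ≤
      κ⁻¹ * Real.exp 81 * Real.exp (-(L / 2048)) := by
    calc (gaussianReal 0 1).real (Set.Iio w) ^ M ≤ Real.exp (-p) ^ M :=
          pow_le_pow_left₀ measureReal_nonneg h2 M
      _ = (Real.exp (p * M))⁻¹ := by rw [← Real.exp_nat_mul, ← Real.exp_neg]; ring_nf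
      _ ≤ (κ * Real.exp (-81) * Real.exp (L / 2048))⁻¹ := by
          gcongr
          linarith [Real.add_one_le_exp (p * M)]
      _ = _ := by
          rw [mul_inv, mul_inv, ← Real.exp_neg, ← Real.exp_neg, neg_neg]
  rw [hpow, add_mul, one_mul]
  exact (stdGaussian_forall_inner_lt_le_tails x hx hxx u u).trans (add_le_add h1 h4)

end GaussianMaximum

section PolarCoordinates
variable {E : Type*} [NormedAddCommGroup E] [InnerProductSpace ℝ E] [FiniteDimensional ℝ E]
  [MeasurableSpace E] [BorelSpace E]

lemma lintegral_eq_lintegral_toSphere_prod [Nontrivial E] {f : E → ℝ≥0∞} (hf : Measurable f) :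
    ∫⁻ x, f x = ∫⁻ p : sphere (0 : E) 1 × Set.Ioi (0 : ℝ), f ((p.2 : ℝ) • (p.1 : E))
      ∂((volume : Measure E).toSphere.prod (Measure.volumeIoiPow (finrank ℝ E - 1))) := by
  have hmp := (volume : Measure E).measurePreserving_homeomorphUnitSphereProd
  have hm : Measurable fun p : sphere (0 : E) 1 × Set.Ioi (0 : ℝ) ↦
      f ((p.2 : ℝ) • (p.1 : E)) := by
    fun_prop
  rw [← hmp.lintegral_comp hm]
  have h1 (x : ({0}ᶜ : Set E)) : (((homeomorphUnitSphereProd E x).2 : ℝ) •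
      ((homeomorphUnitSphereProd E x).1 : E)) = x := by
    have hx : ‖(x : E)‖ ≠ 0 := norm_ne_zero_iff.2 x.2
    simp [smul_smul, hx]
  simp_rw [h1]
  rw [lintegral_subtype_comap (measurableSet_singleton _).compl (fun x : E ↦ f x),
    restrict_compl_singleton]

/-- The direction and the norm of a Gaussian vector are independent, the former being uniform. -/
lemma toSphere_mul_stdGaussian_closedBall_le [Nontrivial E] {A : Set (sphere (0 : E) 1)}
    (hA : MeasurableSet A) {R : ℝ} {S : Set E} (hS : MeasurableSet S)
    (hAS : ∀ θ ∈ A, ∀ r : ℝ, 0 < r → r ≤ R → r • (θ : E) ∈ S) :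
    (((volume : Measure E).toSphere Set.univ)⁻¹ • (volume : Measure E).toSphere) A *
      stdGaussian E (closedBall 0 R) ≤ stdGaussian E S := by
  obtain ⟨c, hc, hdens⟩ := exists_stdGaussian_eq_withDensity (E := E)
  set m := (volume : Measure E).toSphere with hm
  set ρ : ℝ → ℝ≥0∞ := fun r ↦ ENNReal.ofReal (c * Real.exp (-(1 / 2) * r ^ 2)) with hρ
  set K : ℝ≥0∞ := ∫⁻ r : Set.Ioi (0 : ℝ), (Set.Iic R).indicator ρ r
    ∂(Measure.volumeIoiPow (finrank ℝ E - 1))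
  have hρm : Measurable ((Set.Iic R).indicator ρ) :=
    Measurable.indicator (by fun_prop) measurableSet_Iic
  have hpolar {T : Set E} (hT : MeasurableSet T) : stdGaussian E T =
      ∫⁻ p : sphere (0 : E) 1 × Set.Ioi (0 : ℝ),
        T.indicator (fun x ↦ ρ ‖x‖) ((p.2 : ℝ) • (p.1 : E))
          ∂(m.prod (Measure.volumeIoiPow (finrank ℝ E - 1))) := by
    rw [hdens, withDensity_apply _ hT, ← lintegral_indicator hT,
      lintegral_eq_lintegral_toSphere_prod (Measurable.indicator (by fun_prop) hT)]
  have hnorm (p : sphere (0 : E) 1 × Set.Ioi (0 : ℝ)) : ‖(p.2 : ℝ) • (p.1 : E)‖ = p.2 := by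
    rw [norm_smul, norm_eq_of_mem_sphere, mul_one, Real.norm_of_nonneg p.2.2.le]
  have hprod {B : Set (sphere (0 : E) 1)} (hB : MeasurableSet B) :
      ∫⁻ p : sphere (0 : E) 1 × Set.Ioi (0 : ℝ), B.indicator 1 p.1 * (Set.Iic R).indicator ρ p.2
        ∂(m.prod (Measure.volumeIoiPow (finrank ℝ E - 1))) = m B * K := by
    rw [lintegral_prod_mul (f := B.indicator 1)
      (g := fun r : Set.Ioi (0 : ℝ) ↦ (Set.Iic R).indicator ρ (r : ℝ))
      (measurable_one.indicator hB).aemeasurable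
      (hρm.comp measurable_subtype_coe).aemeasurable, lintegral_indicator_one hB]
  have hball : stdGaussian E (closedBall 0 R) = m Set.univ * K := by
    rw [hpolar measurableSet_closedBall, ← hprod MeasurableSet.univ]
    refine lintegral_congr fun p ↦ ?_
    by_cases hp : (p.2 : ℝ) ≤ R
    · rw [Set.indicator_of_mem (by rwa [mem_closedBall_zero_iff, hnorm]), hnorm,
        Set.indicator_of_mem (Set.mem_univ _), Set.indicator_of_mem (by exact hp), Pi.one_apply,
        one_mul]
    · rw [Set.indicator_of_notMem (by rwa [mem_closedBall_zero_iff, hnorm]),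
        Set.indicator_of_notMem (s := Set.Iic R) (by exact hp), mul_zero]
  have hSle : m A * K ≤ stdGaussian E S := by
    rw [hpolar hS, ← hprod hA]
    refine lintegral_mono fun p ↦ ?_
    by_cases hp : (p.2 : ℝ) ≤ R ∧ p.1 ∈ A
    · rw [Set.indicator_of_mem hp.2, Set.indicator_of_mem (s := Set.Iic R) hp.1,
        Set.indicator_of_mem (hAS _ hp.2 _ p.2.2 hp.1), hnorm, Pi.one_apply, one_mul]
    · rcases not_and_or.1 hp with h | h
      · rw [Set.indicator_of_notMem (s := Set.Iic R) (by exact h), mul_zero]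
        exact zero_le
      · rw [Set.indicator_of_notMem h, zero_mul]
        exact zero_le
  have hm0 : m Set.univ ≠ 0 := by
    rw [Measure.measure_univ_ne_zero]
    exact Measure.toSphere_ne_zero _
  calc (((m Set.univ)⁻¹ • m) A) * stdGaussian E (closedBall 0 R)
      = (m Set.univ)⁻¹ * m Set.univ * (m A * K) := by
        rw [hball, Measure.smul_apply, smul_eq_mul]; ring
    _ = m A * K := by rw [ENNReal.inv_mul_cancel hm0 (measure_ne_top _ _), one_mul]
    _ ≤ _ := hSle

lemma integral_norm_sq_stdGaussian :
    Integrable (fun x : E ↦ ‖x‖ ^ 2) (stdGaussian E) ∧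
      ∫ x, ‖x‖ ^ 2 ∂(stdGaussian E) = finrank ℝ E := by
  set b := stdOrthonormalBasis ℝ E
  have hmem (i : Fin (finrank ℝ E)) : MemLp (fun x ↦ ⟪b i, x⟫) 2 (stdGaussian E) :=
    (innerSL ℝ (b i)).comp_memLp' IsGaussian.memLp_two_id
  have hint (i : Fin (finrank ℝ E)) : Integrable (fun x ↦ ⟪b i, x⟫ ^ 2) (stdGaussian E) :=
    (hmem i).integrable_sq
  have hval (i : Fin (finrank ℝ E)) : ∫ x, ⟪b i, x⟫ ^ 2 ∂(stdGaussian E) = 1 := by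
    have h := variance_dual_stdGaussian (innerSL ℝ (b i))
    rw [variance_of_integral_eq_zero (by fun_prop) (integral_strongDual_stdGaussian _),
      innerSL_apply_norm, b.norm_eq_one, one_pow] at h
    exact h
  have hsum (x : E) : ‖x‖ ^ 2 = ∑ i, ⟪b i, x⟫ ^ 2 := (b.sum_sq_inner_right x).symm
  simp_rw [hsum]
  refine ⟨integrable_finsetSum _ fun i _ ↦ hint i, ?_⟩
  rw [integral_finsetSum _ fun i _ ↦ hint i]
  simp [hval]

lemma three_quarters_le_stdGaussian_closedBall [Nontrivial E] :
    3 / 4 ≤ (stdGaussian E).real (closedBall 0 (2 * √(finrank ℝ E))) := by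
  have hd : (0 : ℝ) < finrank ℝ E := by exact_mod_cast finrank_pos
  obtain ⟨hint, hval⟩ := integral_norm_sq_stdGaussian (E := E)
  have hmk := mul_meas_ge_le_integral_of_nonneg (ae_of_all _ fun x : E ↦ sq_nonneg ‖x‖) hint
    (4 * finrank ℝ E)
  rw [hval] at hmk
  have hsub : (closedBall (0 : E) (2 * √(finrank ℝ E)))ᶜ ⊆
      {x : E | 4 * (finrank ℝ E : ℝ) ≤ ‖x‖ ^ 2} := by
    intro x hx
    rw [Set.mem_compl_iff, mem_closedBall_zero_iff, not_le] at hx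
    have := pow_le_pow_left₀ (by positivity) hx.le 2
    rw [mul_pow, Real.sq_sqrt hd.le] at this
    norm_num at this
    exact this
  have h1 := measureReal_mono (μ := stdGaussian E) hsub
  rw [probReal_compl_eq_one_sub measurableSet_closedBall] at h1
  have h2 : (stdGaussian E).real {x : E | 4 * (finrank ℝ E : ℝ) ≤ ‖x‖ ^ 2} ≤ 1 / 4 := by
    by_contra! hcon
    nlinarith
  linarith

lemma sphereMeasure_forall_inner_lt_le {n M : ℕ} (hn : 1 ≤ n)
    (x : Fin M → EuclideanSpace ℝ (Fin n)) (u : ℝ) (hu : 0 ≤ u) :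
    sphereMeasure n {θ | ∀ i, ⟪x i, (θ : EuclideanSpace ℝ (Fin n))⟫ < u / (2 * √n)} ≤
      ENNReal.ofReal (2 * (stdGaussian (EuclideanSpace ℝ (Fin n))).real
        {g | ∀ i, ⟪x i, g⟫ < u}) := by
  have : Nonempty (Fin n) := ⟨⟨0, hn⟩⟩
  have hn0 : (0 : ℝ) < √n := Real.sqrt_pos.2 (by exact_mod_cast hn)
  have hA : MeasurableSet {θ : sphere (0 : EuclideanSpace ℝ (Fin n)) 1 |
      ∀ i, ⟪x i, (θ : EuclideanSpace ℝ (Fin n))⟫ < u / (2 * √n)} := by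
    rw [Set.ofPred_forall]
    exact MeasurableSet.iInter fun i ↦ measurableSet_lt (by fun_prop) measurable_const
  have hS : MeasurableSet {g : EuclideanSpace ℝ (Fin n) | ∀ i, ⟪x i, g⟫ < u} := by
    rw [Set.ofPred_forall]
    exact MeasurableSet.iInter fun i ↦ measurableSet_lt (by fun_prop) measurable_const
  have key := toSphere_mul_stdGaussian_closedBall_le hA (R := 2 * √n) hS fun θ hθ r hr0 hr i ↦ by
    rw [real_inner_smul_right]
    have h := hθ i
    rw [lt_div_iff₀ (by positivity)] at h
    rcases le_or_gt 0 ⟪x i, (θ : EuclideanSpace ℝ (Fin n))⟫ with h0 | h0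
    · nlinarith
    · exact (mul_neg_of_pos_of_neg hr0 h0).trans_le hu
  have h34 := three_quarters_le_stdGaussian_closedBall (E := EuclideanSpace ℝ (Fin n))
  rw [finrank_euclideanSpace_fin] at h34
  change sphereMeasure n _ * _ ≤ _ at key
  have h2 : (2 : ℝ≥0∞)⁻¹ ≤ stdGaussian (EuclideanSpace ℝ (Fin n)) (closedBall 0 (2 * √n)) := by
    rw [← ofReal_measureReal]
    calc (2 : ℝ≥0∞)⁻¹ = ENNReal.ofReal 2⁻¹ := by
          rw [ENNReal.ofReal_inv_of_pos two_pos, ENNReal.ofReal_ofNat]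
      _ ≤ _ := ENNReal.ofReal_le_ofReal (by linarith)
  rw [ENNReal.ofReal_mul two_pos.le, ofReal_measureReal, ENNReal.ofReal_ofNat]
  set a := sphereMeasure n {θ | ∀ i, ⟪x i, (θ : EuclideanSpace ℝ (Fin n))⟫ < u / (2 * √n)}
  calc a = 2 * (a * 2⁻¹) := by
        rw [mul_left_comm, ENNReal.mul_inv_cancel two_ne_zero ENNReal.ofNat_ne_top, mul_one]
    _ ≤ _ := by gcongr; exact (mul_le_mul_right h2 _).trans key

end PolarCoordinates

section Blocks

lemma isProbabilityMeasure_sphereMeasure {n : ℕ} (hn : 1 ≤ n) :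
    IsProbabilityMeasure (sphereMeasure n) := by
  have : Nonempty (Fin n) := ⟨⟨0, hn⟩⟩
  refine ⟨?_⟩
  rw [sphereMeasure, Measure.smul_apply, smul_eq_mul, ENNReal.inv_mul_cancel _ (measure_ne_top _ _)]
  rw [Measure.measure_univ_ne_zero]
  exact Measure.toSphere_ne_zero _

/-- If each of `q` events is unlikely, then it is unlikely that more than half of them occur. -/
lemma measure_lt_two_mul_ncard_le {Ω : Type*} [MeasurableSpace Ω] (μ : Measure Ω) {q : ℕ}
    {B : Fin q → Set Ω} (hB : ∀ j, MeasurableSet (B j)) {p : ℝ≥0∞} (hp : ∀ j, μ (B j) ≤ p) :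
    μ {ω | q < 2 * {j | ω ∈ B j}.ncard} ≤ 2 * p := by
  classical
  rcases Nat.eq_zero_or_pos q with rfl | hq
  · simp [Set.eq_empty_of_isEmpty]
  have hcard (ω : Ω) : (({j | ω ∈ B j}.ncard : ℕ) : ℝ≥0∞) = ∑ j, (B j).indicator 1 ω := by
    rw [Set.ncard_eq_toFinset_card']
    simp [Set.indicator_apply, Finset.sum_boole]
  have hm : Measurable fun ω ↦ 2 * ∑ j, (B j).indicator (1 : Ω → ℝ≥0∞) ω :=
    (Finset.measurable_fun_sum _ fun j _ ↦ measurable_one.indicator (hB j)).const_mul 2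
  have hsub : {ω | q < 2 * {j | ω ∈ B j}.ncard} ⊆
      {ω | (q : ℝ≥0∞) ≤ 2 * ∑ j, (B j).indicator 1 ω} := by
    intro ω hω
    have h : q < 2 * {j | ω ∈ B j}.ncard := hω
    change (q : ℝ≥0∞) ≤ _
    rw [← hcard]
    exact_mod_cast h.le
  have hq0 : (q : ℝ≥0∞) ≠ 0 := by exact_mod_cast hq.ne'
  rw [← ENNReal.mul_le_mul_iff_right hq0 (ENNReal.natCast_ne_top q)]
  calc (q : ℝ≥0∞) * μ {ω | q < 2 * {j | ω ∈ B j}.ncard}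
      ≤ q * μ {ω | (q : ℝ≥0∞) ≤ 2 * ∑ j, (B j).indicator 1 ω} := by gcongr
    _ ≤ ∫⁻ ω, 2 * ∑ j, (B j).indicator 1 ω ∂μ := mul_meas_ge_le_lintegral hm _
    _ = 2 * ∑ j, μ (B j) := by
        rw [lintegral_const_mul _ (Finset.measurable_fun_sum _ fun j _ ↦
          measurable_one.indicator (hB j)), lintegral_finsetSum _ fun j _ ↦
          measurable_one.indicator (hB j)]
        simp_rw [lintegral_indicator_one (hB _)]
    _ ≤ 2 * ∑ _j : Fin q, p := by gcongr with j; exact hp j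
    _ = q * (2 * p) := by simp; ring

/-- The `l`-th index in the `j`-th block, when `{0, …, N - 1}` is cut into blocks of length `M`. -/
def blockIndex (N M : ℕ) (j : Fin (N / M)) (l : Fin M) : Fin N :=
  Fin.castLE (Nat.div_mul_le_self N M) (finProdFinEquiv (j, l))

lemma blockIndex_inj {N M : ℕ} {j j' : Fin (N / M)} {l l' : Fin M} :
    blockIndex N M j l = blockIndex N M j' l' ↔ j = j' ∧ l = l' := by
  rw [blockIndex, blockIndex, (Fin.castLE_injective _).eq_iff, finProdFinEquiv.injective.eq_iff,
    Prod.mk.injEq]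

lemma le_four_mul_ncard_of_block {N M : ℕ} (hM : 1 ≤ M) (hMN : M ≤ N) {f : Fin N → ℝ} {s : ℝ}
    (h : 2 * {j | ∀ l, f (blockIndex N M j l) < s}.ncard ≤ N / M) :
    N ≤ 4 * M * {i | s ≤ f i}.ncard := by
  have hq : 1 ≤ N / M := (Nat.one_le_div_iff hM).2 hMN
  set S : Set (Fin (N / M)) := {j | ∀ l, f (blockIndex N M j l) < s} with hS
  have : Nonempty (Fin M) := ⟨⟨0, hM⟩⟩
  have hgood : ∀ j : Fin (N / M), j ∈ Sᶜ → ∃ l, s ≤ f (blockIndex N M j l) := by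
    intro j hj
    simpa [hS] using hj
  choose! l hl using hgood
  have hle : Sᶜ.ncard ≤ {i | s ≤ f i}.ncard :=
    Set.ncard_le_ncard_of_injOn (fun j ↦ blockIndex N M j (l j)) hl
      (fun j _ j' _ hjj ↦ (blockIndex_inj.1 hjj).1) (Set.toFinite _)
  have hadd := Set.ncard_add_ncard_compl S
  rw [Nat.card_eq_fintype_card, Fintype.card_fin] at hadd
  have hN : N < M * (N / M + 1) := Nat.lt_mul_div_succ N hM
  calc N ≤ M * (N / M + 1) := hN.le
    _ ≤ M * (4 * {i | s ≤ f i}.ncard) := Nat.mul_le_mul_left _ (by omega)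
    _ = _ := by ring

end Blocks

section Scales

/-- The directions in which the majority of blocks of length `M` have all their inner products
below `s`. -/
def lowMajority {n N : ℕ} (x : Fin N → EuclideanSpace ℝ (Fin n)) (M : ℕ) (s : ℝ) :
    Set (sphere (0 : EuclideanSpace ℝ (Fin n)) 1) :=
  {θ | N / M < 2 * {j | ∀ l, ⟪x (blockIndex N M j l), (θ : EuclideanSpace ℝ (Fin n))⟫ < s}.ncard}

lemma exists_sphereMeasure_lowMajority_le :
    ∃ A : ℝ, 0 < A ∧ ∀ (n N : ℕ), 1 ≤ n → ∀ x : Fin N → EuclideanSpace ℝ (Fin n),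
      (∀ i, ‖x i‖ = 1) → (∀ i j, i ≠ j → ⟪x i, x j⟫ ≤ 49 / 50) → ∀ M : ℕ, 1 ≤ M →
      sphereMeasure n (lowMajority x M (√(Real.log M) / 32 / (2 * √n))) ≤
        ENNReal.ofReal (A * (M : ℝ) ^ (-(1 / 2048) : ℝ)) := by
  obtain ⟨A, hA, h⟩ := exists_stdGaussian_forall_inner_lt_sqrt_log_le
  refine ⟨4 * A, by positivity, fun n N hn x hx hxx M hM ↦ ?_⟩
  have hB (j : Fin (N / M)) := sphereMeasure_forall_inner_lt_le hn
    (fun l ↦ x (blockIndex N M j l)) (√(Real.log M) / 32) (by positivity)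
  have hg (j : Fin (N / M)) := h hM (fun l ↦ x (blockIndex N M j l)) (fun l ↦ hx _)
    fun l l' hl ↦ hxx _ _ fun he ↦ hl (blockIndex_inj.1 he).2
  refine (measure_lt_two_mul_ncard_le (sphereMeasure n)
    (B := fun j ↦ {θ | ∀ l, ⟪x (blockIndex N M j l), (θ : EuclideanSpace ℝ (Fin n))⟫ <
      √(Real.log M) / 32 / (2 * √n)}) (fun j ↦ ?_) fun j ↦ (hB j).trans
        (ENNReal.ofReal_le_ofReal (mul_le_mul_of_nonneg_left (hg j) two_pos.le))).trans_eq ?_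
  · rw [Set.ofPred_forall]
    exact MeasurableSet.iInter fun i ↦ measurableSet_lt (by fun_prop) measurable_const
  · rw [← ENNReal.ofReal_ofNat, ← ENNReal.ofReal_mul two_pos.le]
    congr 1
    ring

/-- Union bound over the dyadic scales `M = n * 2 ^ k`. -/
lemma exists_sphereMeasure_iUnion_lowMajority_le :
    ∃ C : ℝ, 0 < C ∧ ∀ (n N : ℕ), 1 ≤ n → ∀ x : Fin N → EuclideanSpace ℝ (Fin n),
      (∀ i, ‖x i‖ = 1) → (∀ i j, i ≠ j → ⟪x i, x j⟫ ≤ 49 / 50) →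
      sphereMeasure n (⋃ k : ℕ, lowMajority x (n * 2 ^ k)
        (√(Real.log ((n * 2 ^ k : ℕ) : ℝ)) / 32 / (2 * √n))) ≤
        ENNReal.ofReal (C / (n : ℝ) ^ (1 / 2048 : ℝ)) := by
  obtain ⟨A, hA, h⟩ := exists_sphereMeasure_lowMajority_le
  set r : ℝ := 2 ^ (-(1 / 2048) : ℝ) with hr
  have hr0 : 0 < r := by positivity
  have hr1 : r < 1 := Real.rpow_lt_one_of_one_lt_of_neg one_lt_two (by norm_num)
  have h1r : 0 < 1 - r := by linarith
  refine ⟨A * (1 - r)⁻¹, by positivity, fun n N hn x hx hxx ↦ ?_⟩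
  have hn0 : (0 : ℝ) < n := by exact_mod_cast hn
  set D : ℝ := A * (n : ℝ) ^ (-(1 / 2048) : ℝ) with hD
  have hD0 : 0 ≤ D := by positivity
  have hgeom := hasSum_geometric_of_lt_one hr0.le hr1
  have hpow (k : ℕ) : A * ((n * 2 ^ k : ℕ) : ℝ) ^ (-(1 / 2048) : ℝ) = D * r ^ k := by
    push_cast
    rw [Real.mul_rpow hn0.le (by positivity), ← Real.rpow_natCast_mul two_pos.le, mul_comm (k : ℝ),
      Real.rpow_mul_natCast two_pos.le]
    ring
  calc _ ≤ ∑' k : ℕ, sphereMeasure n (lowMajority x (n * 2 ^ k)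
        (√(Real.log ((n * 2 ^ k : ℕ) : ℝ)) / 32 / (2 * √n))) := measure_iUnion_le _
    _ ≤ ∑' k : ℕ, ENNReal.ofReal (D * r ^ k) := by
        refine ENNReal.tsum_le_tsum fun k ↦ ?_
        rw [← hpow]
        exact h n N hn x hx hxx _ (Nat.one_le_iff_ne_zero.2 (by positivity))
    _ = ENNReal.ofReal (D * (1 - r)⁻¹) := by
        rw [← ENNReal.ofReal_tsum_of_nonneg (fun k ↦ by positivity)
          (hgeom.mul_left D).summable, (hgeom.mul_left D).tsum_eq]
    _ = _ := by
        congr 1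
        rw [hD, Real.rpow_neg hn0.le]
        ring

lemma exists_mul_two_pow_le_lt {n : ℕ} (hn : 1 ≤ n) {y : ℝ} (hy : n ≤ y) :
    ∃ k : ℕ, ((n * 2 ^ k : ℕ) : ℝ) ≤ y ∧ y < 2 * ((n * 2 ^ k : ℕ) : ℝ) := by
  have hn0 : (0 : ℝ) < n := by exact_mod_cast hn
  obtain ⟨k, h1, h2⟩ := exists_nat_pow_near ((one_le_div hn0).2 hy) one_lt_two
  rw [le_div_iff₀ hn0] at h1
  rw [div_lt_iff₀ hn0, pow_succ] at h2
  exact ⟨k, by push_cast; linarith, by push_cast; linarith⟩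

lemma exp_le_ncard_div_of_notMem_lowMajority {n N M : ℕ} (hn : 1 ≤ n) (hM : 2 ≤ M) (hMN : M ≤ N)
    (x : Fin N → EuclideanSpace ℝ (Fin n)) {θ : sphere (0 : EuclideanSpace ℝ (Fin n)) 1}
    (hθ : θ ∉ lowMajority x M (√(Real.log M) / 32 / (2 * √n))) {t : ℝ}
    (hMt : M ≤ Real.exp (t ^ 2)) (htM : Real.exp (t ^ 2) < 2 * M) :
    1 / 4 * Real.exp (-1 * t ^ 2) ≤ (({i : Fin N | 1 / 128 * t / √n ≤
      ⟪x i, (θ : EuclideanSpace ℝ (Fin n))⟫} : Set (Fin N)).ncard : ℝ) / N := by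
  have hn0 : (0 : ℝ) < √n := Real.sqrt_pos.2 (by exact_mod_cast hn)
  have hM2 : (2 : ℝ) ≤ M := by exact_mod_cast hM
  have hM0 : (0 : ℝ) < M := by linarith
  have hN0 : (0 : ℝ) < N := hM0.trans_le (by exact_mod_cast hMN)
  have hcount := le_four_mul_ncard_of_block (by omega) hMN
    (f := fun i ↦ ⟪x i, (θ : EuclideanSpace ℝ (Fin n))⟫) (not_lt.1 hθ)
  have ht : t ≤ 2 * √(Real.log M) := by
    have h1 : t ^ 2 < Real.log (2 * M) := (Real.lt_log_iff_exp_lt (by positivity)).2 htM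
    rw [Real.log_mul two_ne_zero hM0.ne'] at h1
    have h2 : Real.log 2 ≤ Real.log M := Real.log_le_log two_pos hM2
    have h3 : 0 ≤ Real.log M := Real.log_nonneg (by linarith)
    refine (Real.le_sqrt_of_sq_le (by linarith : t ^ 2 ≤ 2 ^ 2 * Real.log M)).trans_eq ?_
    rw [Real.sqrt_mul (by positivity), Real.sqrt_sq two_pos.le]
  have hs : 1 / 128 * t / √n ≤ √(Real.log M) / 32 / (2 * √n) := by
    rw [div_div _ 32, div_le_div_iff₀ hn0 (by positivity)]
    nlinarith
  have hle : {i : Fin N | √(Real.log M) / 32 / (2 * √n) ≤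
      ⟪x i, (θ : EuclideanSpace ℝ (Fin n))⟫}.ncard ≤
      {i : Fin N | 1 / 128 * t / √n ≤ ⟪x i, (θ : EuclideanSpace ℝ (Fin n))⟫}.ncard :=
    Set.ncard_le_ncard (fun i hi ↦ hs.trans hi) (Set.toFinite _)
  have hfin := hcount.trans (Nat.mul_le_mul_left (4 * M) hle)
  set P := {i : Fin N | 1 / 128 * t / √n ≤ ⟪x i, (θ : EuclideanSpace ℝ (Fin n))⟫}.ncard
  have hfin' : (N : ℝ) ≤ 4 * M * P := by exact_mod_cast hfin
  rw [le_div_iff₀ hN0, neg_one_mul, Real.exp_neg]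
  calc 1 / 4 * (Real.exp (t ^ 2))⁻¹ * N ≤ 1 / 4 * (M : ℝ)⁻¹ * (4 * M * P) := by gcongr
    _ = P := by field_simp

end Scales

end

/-- **Lemma 4.3.** Let `N ≥ n` and let `x_1, …, x_N` be unit vectors with
`⟨x_i, x_j⟩ ≤ 49/50` for `i ≠ j`. Then there is `F ⊆ S^{n-1}` with
`σ_{n-1}(F) ≥ 1 - C/n^c` such that for every `θ ∈ F` and every
`t ∈ [√(log n), √(log N)]`, the proportion of indices `i` with
`⟨x_i, θ⟩ ≥ c1 t/√n` is at least `c2 e^{-C3 t²}`. -/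
theorem separated_points_supergaussian_directions :
    ∃ c1 c2 C3 c C : ℝ, 0 < c1 ∧ 0 < c2 ∧ 0 < C3 ∧ 0 < c ∧ 0 < C ∧
      ∀ (n N : ℕ), 1 ≤ n → n ≤ N →
      ∀ x : Fin N → EuclideanSpace ℝ (Fin n),
        (∀ i, ‖x i‖ = 1) →
        (∀ i j, i ≠ j → ⟪x i, x j⟫ ≤ 49 / 50) →
        ∃ F : Set (sphere (0 : EuclideanSpace ℝ (Fin n)) 1),
          ENNReal.ofReal (1 - C / (n : ℝ) ^ c) ≤ sphereMeasure n F ∧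
          ∀ θ ∈ F, ∀ t : ℝ,
            Real.sqrt (Real.log n) ≤ t → t ≤ Real.sqrt (Real.log N) →
            c2 * Real.exp (-C3 * t ^ 2) ≤
              (({i : Fin N | c1 * t / Real.sqrt n ≤
                ⟪x i, (θ : EuclideanSpace ℝ (Fin n))⟫} : Set (Fin N)).ncard : ℝ) / N := by
  obtain ⟨C, hC, h⟩ := exists_sphereMeasure_iUnion_lowMajority_le
  refine ⟨1 / 128, 1 / 4, 1, 1 / 2048, max 1 C, by norm_num, by norm_num, by norm_num,
    by norm_num, by positivity, fun n N hn hnN x hx hxx ↦ ?_⟩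
  rcases hn.eq_or_lt with rfl | hn2
  · exact ⟨∅, by simp, by simp⟩
  have := isProbabilityMeasure_sphereMeasure hn
  have hn0 : (0 : ℝ) < n := by exact_mod_cast hn
  have hN0 : (0 : ℝ) < N := by exact_mod_cast hn.trans hnN
  set U := ⋃ k : ℕ, lowMajority x (n * 2 ^ k)
    (√(Real.log ((n * 2 ^ k : ℕ) : ℝ)) / 32 / (2 * √n)) with hU
  refine ⟨Uᶜ, ?_, fun θ hθ t ht1 ht2 ↦ ?_⟩
  · calc ENNReal.ofReal (1 - max 1 C / (n : ℝ) ^ (1 / 2048 : ℝ))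
        ≤ ENNReal.ofReal (1 - C / (n : ℝ) ^ (1 / 2048 : ℝ)) := by
          gcongr; exact le_max_right _ _
      _ = 1 - ENNReal.ofReal (C / (n : ℝ) ^ (1 / 2048 : ℝ)) := by
          rw [ENNReal.ofReal_sub _ (by positivity), ENNReal.ofReal_one]
      _ ≤ 1 - sphereMeasure n U := tsub_le_tsub_left (h n N hn x hx hxx) _
      _ ≤ sphereMeasure n Uᶜ := by
          rw [tsub_le_iff_right, add_comm, ← measure_univ (μ := sphereMeasure n),
            ← Set.union_compl_self U]
          exact measure_union_le _ _
  · have ht0 : 0 ≤ t := (Real.sqrt_nonneg _).trans ht1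
    have hnt : (n : ℝ) ≤ Real.exp (t ^ 2) := by
      rw [← Real.log_le_iff_le_exp hn0]
      exact (Real.sqrt_le_left ht0).1 ht1
    have htN : Real.exp (t ^ 2) ≤ N := by
      rw [← Real.le_log_iff_exp_le hN0]
      exact (Real.le_sqrt' (by
        refine lt_of_lt_of_le (Real.sqrt_pos.2 (Real.log_pos ?_)) ht1
        exact_mod_cast hn2)).1 ht2
    obtain ⟨k, hk1, hk2⟩ := exists_mul_two_pow_le_lt hn hnt
    refine exp_le_ncard_div_of_notMem_lowMajority hn ?_ (by exact_mod_cast hk1.trans htN) x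
      (fun hmem ↦ hθ (Set.mem_iUnion.2 ⟨k, hmem⟩)) hk1 hk2
    exact le_trans hn2 (Nat.le_mul_of_pos_right n (by positivity))
end
end
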